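/- arXiv:0903.5361 — 3 statements merged into one kernel-verified Lean document; each statement's English description precedes it below -/
import Mathlib

section
/- Let D be a disk-polygon with center parameter d, where 0 < d < 1. Then the area of D is strictly larger than the area of the outer parallel domain of radius 1−d of a Reuleaux triangle of width d; explicitly, volume(D) > (1/2)·(π − √3)·d² − π·d + π. -/
open Metric Real MeasureTheory
open scoped InnerProductSpace Pointwise ENNReal

noncomputable section

/-- The Euclidean plane. -/
abbrev E2 := EuclideanSpace ℝ (Fin 2)

/-- The point of the Euclidean plane with the given coordinates. -/
def pt (a b : ℝ) : E2 := (EuclideanSpace.equiv (Fin 2) ℝ).symm ![a, b]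

/-- The width of a set `C` in the direction of the unit vector `u`. -/
def dirWidth (C : Set E2) (u : E2) : ℝ :=
  sSup {w : ℝ | ∃ x ∈ C, ∃ y ∈ C, w = ⟪x - y, u⟫_ℝ}

/-- The minimal width of a set: the infimum of the directional widths over all
unit vectors. -/
def minWidth (C : Set E2) : ℝ :=
  sInf {w : ℝ | ∃ u : E2, ‖u‖ = 1 ∧ w = dirWidth C u}

/-- The inradius of a set. -/
def inradius (C : Set E2) : ℝ :=
  sSup {r : ℝ | 0 ≤ r ∧ ∃ c : E2, closedBall c r ⊆ C}

/-- The circumradius of a set. -/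
def circumradius (C : Set E2) : ℝ :=
  sInf {r : ℝ | 0 ≤ r ∧ ∃ c : E2, C ⊆ closedBall c r}

/-- The dual disk-polygon of a set `D`. -/
def dualDP (D : Set E2) : Set E2 := {y : E2 | ∀ x ∈ D, dist x y ≤ 1}

/-- Squared Euclidean distance on `ℝ × ℝ`. -/
def sqd (p q : ℝ × ℝ) : ℝ := (p.1 - q.1) ^ 2 + (p.2 - q.2) ^ 2

lemma sqd_continuous (w : ℝ × ℝ) : Continuous (fun p => sqd p w) := by
  unfold sqd; fun_prop

/-- Every set of diameter at most `d` extends to a diametrically complete one. -/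
lemma exists_complete (d : ℝ) (S : Set (ℝ × ℝ)) (hS : ∀ p ∈ S, ∀ q ∈ S, sqd p q ≤ d ^ 2) :
    ∃ W : Set (ℝ × ℝ), S ⊆ W ∧ (∀ p ∈ W, ∀ q ∈ W, sqd p q ≤ d ^ 2) ∧
      ∀ x, (∀ w ∈ W, sqd x w ≤ d ^ 2) → x ∈ W := by
  obtain ⟨W, hSW, hW⟩ := zorn_subset_nonempty
    {T : Set (ℝ × ℝ) | ∀ p ∈ T, ∀ q ∈ T, sqd p q ≤ d ^ 2} (by
      intro c hc hchain _
      refine ⟨⋃₀ c, ?_, fun s hs => Set.subset_sUnion_of_mem hs⟩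
      rintro p ⟨s, hs, hp⟩ q ⟨t, ht, hq⟩
      rcases hchain.total hs ht with h | h
      · exact hc ht p (h hp) q hq
      · exact hc hs p hp q (h hq)) S hS
  refine ⟨W, hSW, hW.prop, ?_⟩
  intro x hx
  have hins : (insert x W) ∈ {T : Set (ℝ × ℝ) | ∀ p ∈ T, ∀ q ∈ T, sqd p q ≤ d ^ 2} := by
    intro p hp q hq
    rcases hp with rfl | hp <;> rcases hq with rfl | hq
    · simp [sqd]; positivity
    · exact hx q hq
    · have := hx p hp
      unfold sqd at *; nlinarith
    · exact hW.prop p hp q hq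
  exact hW.le_of_ge hins (Set.subset_insert x W) (Set.mem_insert x W)

lemma complete_compact (d : ℝ) (hd : 0 < d) (W : Set (ℝ × ℝ))
    (hW : ∀ p ∈ W, ∀ q ∈ W, sqd p q ≤ d ^ 2)
    (hc : ∀ x, (∀ w ∈ W, sqd x w ≤ d ^ 2) → x ∈ W) : IsCompact W := by
  have hclosed : IsClosed W := by
    have : W = ⋂ w ∈ W, {x | sqd x w ≤ d ^ 2} := by
      ext x
      simp only [Set.mem_iInter, Set.mem_ofPred_eq]
      exact ⟨fun hx w hw => hW x hx w hw, hc x⟩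
    rw [this]
    exact isClosed_biInter fun w _ => isClosed_le (sqd_continuous w) continuous_const
  refine Metric.isCompact_of_isClosed_isBounded hclosed ?_
  rw [Metric.isBounded_iff]
  refine ⟨d, fun p hp q hq => ?_⟩
  have h := hW p hp q hq
  unfold sqd at h
  rw [Prod.dist_eq, Real.dist_eq, Real.dist_eq]
  exact max_le (abs_le_of_sq_le_sq (by nlinarith [sq_nonneg (p.2 - q.2)]) hd.le)
    (abs_le_of_sq_le_sq (by nlinarith [sq_nonneg (p.1 - q.1)]) hd.le)

/-- At a support point in direction `(a, b)`, on each side there is a point at distance `d`. -/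
lemma exists_block (d : ℝ) (W : Set (ℝ × ℝ)) (hcomp : IsCompact W)
    (hW : ∀ p ∈ W, ∀ q ∈ W, sqd p q ≤ d ^ 2)
    (hc : ∀ x, (∀ w ∈ W, sqd x w ≤ d ^ 2) → x ∈ W)
    (a b : ℝ) (hab : a ^ 2 + b ^ 2 = 1) (x : ℝ × ℝ) (hx : x ∈ W)
    (hmax : ∀ w ∈ W, a * w.1 + b * w.2 ≤ a * x.1 + b * x.2)
    (s : ℝ) :
    ∃ w ∈ W, sqd x w = d ^ 2 ∧ 0 ≤ s * (-b * (x.1 - w.1) + a * (x.2 - w.2)) := by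
  let e : ℕ → ℝ := fun n => 1 / ((n : ℝ) + 1)
  have he : ∀ n, 0 < e n := fun n => by positivity
  let v : ℕ → ℝ × ℝ := fun n => (-(s * b) + e n * a, s * a + e n * b)
  have key : ∀ n, ∃ w ∈ W, d ^ 2 < sqd (x.1 + e n * (v n).1, x.2 + e n * (v n).2) w := by
    intro n
    by_contra hcon
    push Not at hcon
    have h1 := hmax _ (hc _ hcon)
    simp only [v] at h1
    have : 0 < e n * e n := mul_pos (he n) (he n)
    nlinarith
  choose w hwW hw using key
  obtain ⟨w0, hw0, φ, hφ, hlim⟩ := hcomp.tendsto_subseq hwW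
  have helim : Filter.Tendsto (fun n => e (φ n)) Filter.atTop (nhds 0) :=
    (tendsto_one_div_add_atTop_nhds_zero_nat (𝕜 := ℝ)).comp hφ.tendsto_atTop
  have hl1 : Filter.Tendsto (fun n => (w (φ n)).1) Filter.atTop (nhds w0.1) :=
    (continuous_fst.tendsto _).comp hlim
  have hl2 : Filter.Tendsto (fun n => (w (φ n)).2) Filter.atTop (nhds w0.2) :=
    (continuous_snd.tendsto _).comp hlim
  have F : Continuous (fun t : ℝ × ℝ × ℝ =>
      sqd (x.1 + t.1 * (-(s * b) + t.1 * a), x.2 + t.1 * (s * a + t.1 * b)) t.2) := by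
    unfold sqd; fun_prop
  have G : Continuous (fun t : ℝ × ℝ × ℝ =>
      2 * ((-(s * b) + t.1 * a) * (x.1 - t.2.1) + (s * a + t.1 * b) * (x.2 - t.2.2))
        + t.1 * ((-(s * b) + t.1 * a) ^ 2 + (s * a + t.1 * b) ^ 2)) := by
    fun_prop
  have hT : Filter.Tendsto (fun n => (e (φ n), w (φ n))) Filter.atTop (nhds (0, w0)) :=
    helim.prodMk_nhds hlim
  have hF := (F.tendsto (0, w0)).comp hT
  have hG := (G.tendsto (0, w0)).comp hT
  refine ⟨w0, hw0, ?_, ?_⟩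
  · apply le_antisymm (hW x hx w0 hw0)
    have := ge_of_tendsto' hF (b := d ^ 2) (fun n => (hw (φ n)).le)
    simpa using this
  · have := ge_of_tendsto' hG (b := 0) (fun n => by
      have h1 := hw (φ n)
      have h2 := hW x hx _ (hwW (φ n))
      have h3 := he (φ n)
      simp only [Function.comp]
      by_contra hneg
      push Not at hneg
      have h4 := mul_neg_of_pos_of_neg h3 hneg
      simp only [sqd, v] at h1 h2
      nlinarith)
    simp only [zero_mul, add_zero] at this
    linarith

lemma arc_algebra (d α1 α2 β1 β2 ζ1 ζ2 : ℝ) (hd : 0 < d)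
    (A1 : α1 ≤ 0) (B1 : β1 ≤ 0) (A2 : α2 ≤ 0) (B2 : 0 ≤ β2)
    (hA : α1 ^ 2 + α2 ^ 2 = d ^ 2) (hB : β1 ^ 2 + β2 ^ 2 = d ^ 2)
    (hzA : (ζ1 - α1) ^ 2 + (ζ2 - α2) ^ 2 ≤ d ^ 2)
    (hzB : (ζ1 - β1) ^ 2 + (ζ2 - β2) ^ 2 ≤ d ^ 2)
    (hAB : (α1 - β1) ^ 2 + (α2 - β2) ^ 2 ≤ d ^ 2) :
    ζ1 ^ 2 + ζ2 ^ 2 + 2 * d * ζ1 ≤ 0 := by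
  have zA : ζ1 ^ 2 + ζ2 ^ 2 ≤ 2 * (ζ1 * α1 + ζ2 * α2) := by linarith
  have zB : ζ1 ^ 2 + ζ2 ^ 2 ≤ 2 * (ζ1 * β1 + ζ2 * β2) := by linarith
  have dA : -α1 ≤ d := abs_le_of_sq_le_sq' (by nlinarith [sq_nonneg α2]) hd.le |>.1 |> neg_le.1
  have dB : -β1 ≤ d := abs_le_of_sq_le_sq' (by nlinarith [sq_nonneg β2]) hd.le |>.1 |> neg_le.1
  have D1 : 0 ≤ α2 * β1 := mul_nonneg_of_nonpos_of_nonpos A2 B1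
  have D2 : β2 * α1 ≤ 0 := mul_nonpos_of_nonneg_of_nonpos B2 A1
  by_cases hD : 0 < α2 * β1 - β2 * α1
  · have e1 : (α2 * β1 - β2 * α1) * (ζ1 ^ 2 + ζ2 ^ 2 + 2 * d * ζ1) ≤ 0 := by
      have t1 := mul_le_mul_of_nonneg_left zA (mul_nonneg hd.le B2)
      have t2 := mul_le_mul_of_nonneg_left zB (mul_nonneg hd.le (neg_nonneg.2 A2))
      have t3 : α2 * β1 - β2 * α1 ≤ d * (β2 - α2) := by nlinarith
      have t4 := mul_le_mul_of_nonneg_right t3 (by positivity : 0 ≤ ζ1 ^ 2 + ζ2 ^ 2)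
      nlinarith
    by_contra hn
    push Not at hn
    have := mul_pos hD hn
    linarith
  · have E1 : α2 * β1 = 0 := by linarith
    have E2 : β2 * α1 = 0 := by linarith
    rcases mul_eq_zero.1 E1 with h | h
    · have : α1 = -d := by
        have : (α1 - d) * (α1 + d) = 0 := by rw [h] at hA; linarith
        rcases mul_eq_zero.1 this with h | h <;> linarith
      rw [this, h] at zA; linarith
    · have hb : β2 = d := by
        have : (β2 - d) * (β2 + d) = 0 := by rw [h] at hB; linarith
        rcases mul_eq_zero.1 this with h | h <;> linarith
      have h1 : α1 = 0 := by
        rcases mul_eq_zero.1 E2 with h | h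
        · linarith
        · exact h
      have h2 : α2 = -d := by
        have : (α2 - d) * (α2 + d) = 0 := by rw [h1] at hA; linarith
        rcases mul_eq_zero.1 this with h | h <;> linarith
      rw [h, h1, hb, h2] at hAB
      nlinarith

lemma support_opposite (d : ℝ) (hd : 0 < d) (W : Set (ℝ × ℝ)) (hcomp : IsCompact W)
    (hne : W.Nonempty)
    (hW : ∀ p ∈ W, ∀ q ∈ W, sqd p q ≤ d ^ 2)
    (hc : ∀ x, (∀ w ∈ W, sqd x w ≤ d ^ 2) → x ∈ W)
    (a b : ℝ) (hab : a ^ 2 + b ^ 2 = 1) :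
    ∃ x ∈ W, (x.1 - d * a, x.2 - d * b) ∈ W := by
  obtain ⟨x, hx, hmax⟩ := hcomp.exists_isMaxOn hne
    (f := fun w : ℝ × ℝ => a * w.1 + b * w.2) (by fun_prop)
  have hmax' : ∀ w ∈ W, a * w.1 + b * w.2 ≤ a * x.1 + b * x.2 := fun w hw => hmax hw
  refine ⟨x, hx, ?_⟩
  obtain ⟨p, hp, hp1, hp2⟩ := exists_block d W hcomp hW hc a b hab x hx hmax' 1
  obtain ⟨q, hq, hq1, hq2⟩ := exists_block d W hcomp hW hc a b hab x hx hmax' (-1)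
  apply hc
  intro z hz
  have hz1 := hW z hz p hp
  have hz2 := hW z hz q hq
  have hpq := hW p hp q hq
  have hpm := hmax' p hp
  have hqm := hmax' q hq
  -- coordinates in the rotated frame
  obtain ⟨α1, hα1⟩ : ∃ t, t = a * (p.1 - x.1) + b * (p.2 - x.2) := ⟨_, rfl⟩
  obtain ⟨α2, hα2⟩ : ∃ t, t = -b * (p.1 - x.1) + a * (p.2 - x.2) := ⟨_, rfl⟩
  obtain ⟨β1, hβ1⟩ : ∃ t, t = a * (q.1 - x.1) + b * (q.2 - x.2) := ⟨_, rfl⟩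
  obtain ⟨β2, hβ2⟩ : ∃ t, t = -b * (q.1 - x.1) + a * (q.2 - x.2) := ⟨_, rfl⟩
  obtain ⟨ζ1, hζ1⟩ : ∃ t, t = a * (z.1 - x.1) + b * (z.2 - x.2) := ⟨_, rfl⟩
  obtain ⟨ζ2, hζ2⟩ : ∃ t, t = -b * (z.1 - x.1) + a * (z.2 - x.2) := ⟨_, rfl⟩
  have ep1 : p.1 = x.1 + (a * α1 - b * α2) := by
    rw [hα1, hα2]; linear_combination (-(p.1 - x.1)) * hab
  have ep2 : p.2 = x.2 + (b * α1 + a * α2) := by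
    rw [hα1, hα2]; linear_combination (-(p.2 - x.2)) * hab
  have eq1 : q.1 = x.1 + (a * β1 - b * β2) := by
    rw [hβ1, hβ2]; linear_combination (-(q.1 - x.1)) * hab
  have eq2 : q.2 = x.2 + (b * β1 + a * β2) := by
    rw [hβ1, hβ2]; linear_combination (-(q.2 - x.2)) * hab
  have ez1 : z.1 = x.1 + (a * ζ1 - b * ζ2) := by
    rw [hζ1, hζ2]; linear_combination (-(z.1 - x.1)) * hab
  have ez2 : z.2 = x.2 + (b * ζ1 + a * ζ2) := by
    rw [hζ1, hζ2]; linear_combination (-(z.2 - x.2)) * hab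
  have A1 : α1 ≤ 0 := by rw [hα1]; linarith
  have B1 : β1 ≤ 0 := by rw [hβ1]; linarith
  have A2 : α2 ≤ 0 := by rw [hα2]; linarith
  have B2 : 0 ≤ β2 := by rw [hβ2]; linarith
  simp only [sqd, ep1, ep2, eq1, eq2, ez1, ez2] at hp1 hq1 hz1 hz2 hpq ⊢
  have hA : α1 ^ 2 + α2 ^ 2 = d ^ 2 := by
    linear_combination hp1 - (α1 ^ 2 + α2 ^ 2) * hab
  have hB : β1 ^ 2 + β2 ^ 2 = d ^ 2 := by
    linear_combination hq1 - (β1 ^ 2 + β2 ^ 2) * hab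
  have hzA : (ζ1 - α1) ^ 2 + (ζ2 - α2) ^ 2 ≤ d ^ 2 := by
    linear_combination hz1 - ((ζ1 - α1) ^ 2 + (ζ2 - α2) ^ 2) * hab
  have hzB : (ζ1 - β1) ^ 2 + (ζ2 - β2) ^ 2 ≤ d ^ 2 := by
    linear_combination hz2 - ((ζ1 - β1) ^ 2 + (ζ2 - β2) ^ 2) * hab
  have hAB : (α1 - β1) ^ 2 + (α2 - β2) ^ 2 ≤ d ^ 2 := by
    linear_combination hpq - ((α1 - β1) ^ 2 + (α2 - β2) ^ 2) * hab
  have goal := arc_algebra d α1 α2 β1 β2 ζ1 ζ2 hd A1 B1 A2 B2 hA hB hzA hzB hAB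
  have hid : (x.1 - d * a - (x.1 + (a * ζ1 - b * ζ2))) ^ 2
      + (x.2 - d * b - (x.2 + (b * ζ1 + a * ζ2))) ^ 2
      = d ^ 2 + (ζ1 ^ 2 + ζ2 ^ 2 + 2 * d * ζ1) := by
    linear_combination ((d + ζ1) ^ 2 + ζ2 ^ 2) * hab
  rw [hid]; linarith

/-- The data of a constant width completion, given by a boundary parametrisation by the normal
angle. -/
structure CW (d : ℝ) (S : Set (ℝ × ℝ)) (X Y : ℝ → ℝ) : Prop where
  near : ∀ t, ∀ c ∈ S, (X t - c.1) ^ 2 + (Y t - c.2) ^ 2 ≤ d ^ 2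
  diam : ∀ t s, (X t - X s) ^ 2 + (Y t - Y s) ^ 2 ≤ d ^ 2
  oppX : ∀ t, X (t + Real.pi) = X t - d * Real.cos t
  oppY : ∀ t, Y (t + Real.pi) = Y t - d * Real.sin t

lemma exists_CW (d : ℝ) (hd : 0 < d) (S : Set (ℝ × ℝ)) (hne : S.Nonempty)
    (hS : ∀ p ∈ S, ∀ q ∈ S, sqd p q ≤ d ^ 2) : ∃ X Y : ℝ → ℝ, CW d S X Y := by
  obtain ⟨W, hSW, hW, hc⟩ := exists_complete d S hS
  have hcomp := complete_compact d hd W hW hc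
  have h := fun t : ℝ => support_opposite d hd W hcomp (hne.mono hSW) hW hc (Real.cos t) (Real.sin t)
    (by rw [add_comm]; exact Real.sin_sq_add_cos_sq t)
  choose x hx hx' using h
  have hopp : ∀ t, (x (t + Real.pi)).1 = (x t).1 - d * Real.cos t ∧
      (x (t + Real.pi)).2 = (x t).2 - d * Real.sin t := by
    intro t
    have h1 := hW _ (hx (t + Real.pi)) _ (hx t)
    have h2 := hW _ (hx' (t + Real.pi)) _ (hx' t)
    simp only [sqd, Real.cos_add_pi, Real.sin_add_pi] at h1 h2
    have hcs := Real.sin_sq_add_cos_sq t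
    generalize hD1 : (x (t + Real.pi)).1 - ((x t).1 - d * Real.cos t) = D1
    generalize hD2 : (x (t + Real.pi)).2 - ((x t).2 - d * Real.sin t) = D2
    have e1 : (x (t + Real.pi)).1 = (x t).1 - d * Real.cos t + D1 := by linarith
    have e2 : (x (t + Real.pi)).2 = (x t).2 - d * Real.sin t + D2 := by linarith
    rw [e1, e2] at h1 h2
    have h3 : D1 ^ 2 + D2 ^ 2 ≤ 0 := by nlinarith
    have : D1 = 0 := by nlinarith [sq_nonneg D1, sq_nonneg D2]
    have : D2 = 0 := by nlinarith [sq_nonneg D1, sq_nonneg D2]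
    constructor <;> linarith
  exact ⟨fun t => (x t).1, fun t => (x t).2, fun t c hcS => hW _ (hx t) _ (hSW hcS),
    fun t s => hW _ (hx t) _ (hx s), fun t => (hopp t).1, fun t => (hopp t).2⟩

lemma CW.gap {d : ℝ} {S : Set (ℝ × ℝ)} {X Y : ℝ → ℝ} (h : CW d S X Y) (t s : ℝ) :
    (X s - X t) ^ 2 + (Y s - Y t) ^ 2
      + 2 * d * ((X s - X t) * Real.cos t + (Y s - Y t) * Real.sin t) ≤ 0 := by
  have h1 := h.diam s (t + Real.pi)
  rw [h.oppX, h.oppY] at h1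
  have := Real.sin_sq_add_cos_sq t
  linear_combination h1 - d ^ 2 * this

lemma CW.support {d : ℝ} (hd : 0 < d) {S : Set (ℝ × ℝ)} {X Y : ℝ → ℝ} (h : CW d S X Y)
    (t s : ℝ) :
    X s * Real.cos t + Y s * Real.sin t ≤ X t * Real.cos t + Y t * Real.sin t := by
  have h1 := h.gap t s
  by_contra hn
  push Not at hn
  have : 0 < d * ((X s - X t) * Real.cos t + (Y s - Y t) * Real.sin t) :=
    mul_pos hd (by linarith)
  nlinarith [sq_nonneg (X s - X t), sq_nonneg (Y s - Y t)]

lemma CW.support_mem {d : ℝ} (hd : 0 < d) {S : Set (ℝ × ℝ)} {X Y : ℝ → ℝ} (h : CW d S X Y)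
    (t : ℝ) (c : ℝ × ℝ) (hc : c ∈ S) :
    c.1 * Real.cos t + c.2 * Real.sin t ≤ X t * Real.cos t + Y t * Real.sin t := by
  have h1 := h.near (t + Real.pi) c hc
  rw [h.oppX, h.oppY] at h1
  have := Real.sin_sq_add_cos_sq t
  have h2 : (c.1 - X t) ^ 2 + (c.2 - Y t) ^ 2
      + 2 * d * ((c.1 - X t) * Real.cos t + (c.2 - Y t) * Real.sin t) ≤ 0 := by
    linear_combination h1 - d ^ 2 * this
  by_contra hn
  push Not at hn
  have : 0 < d * ((c.1 - X t) * Real.cos t + (c.2 - Y t) * Real.sin t) :=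
    mul_pos hd (by linarith)
  nlinarith [sq_nonneg (c.1 - X t), sq_nonneg (c.2 - Y t)]

lemma CW.mono {d : ℝ} {S : Set (ℝ × ℝ)} {X Y : ℝ → ℝ} (h : CW d S X Y) (t s : ℝ) :
    (X s - X t) ^ 2 + (Y s - Y t) ^ 2 ≤
      d * ((X s - X t) * (Real.cos s - Real.cos t) + (Y s - Y t) * (Real.sin s - Real.sin t)) := by
  have h1 := h.gap t s
  have h2 := h.gap s t
  linarith

lemma CW.lip {d : ℝ} {S : Set (ℝ × ℝ)} {X Y : ℝ → ℝ} (h : CW d S X Y) (t s : ℝ) :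
    (X s - X t) ^ 2 + (Y s - Y t) ^ 2 ≤ d ^ 2 * (s - t) ^ 2 := by
  have h1 := h.mono t s
  have h2 : (Real.cos s - Real.cos t) ^ 2 + (Real.sin s - Real.sin t) ^ 2 ≤ (s - t) ^ 2 := by
    have h3 := Real.one_sub_sq_div_two_le_cos (x := s - t)
    rw [Real.cos_sub] at h3
    nlinarith [Real.sin_sq_add_cos_sq s, Real.sin_sq_add_cos_sq t]
  have h4 : (X s - X t) ^ 2 + (Y s - Y t) ^ 2 ≤
      d ^ 2 * ((Real.cos s - Real.cos t) ^ 2 + (Real.sin s - Real.sin t) ^ 2) := by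
    nlinarith [sq_nonneg (X s - X t - d * (Real.cos s - Real.cos t)),
      sq_nonneg (Y s - Y t - d * (Real.sin s - Real.sin t))]
  exact h4.trans (mul_le_mul_of_nonneg_left h2 (sq_nonneg d))

lemma CW.lipX {d : ℝ} (hd : 0 < d) {S : Set (ℝ × ℝ)} {X Y : ℝ → ℝ} (h : CW d S X Y) :
    LipschitzWith d.toNNReal X := by
  apply LipschitzWith.of_dist_le_mul
  intro s t
  rw [Real.coe_toNNReal d hd.le, Real.dist_eq, Real.dist_eq, ← abs_of_pos hd, ← abs_mul]
  apply sq_le_sq.1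
  have := h.lip t s
  nlinarith [sq_nonneg (Y s - Y t)]

lemma CW.lipY {d : ℝ} (hd : 0 < d) {S : Set (ℝ × ℝ)} {X Y : ℝ → ℝ} (h : CW d S X Y) :
    LipschitzWith d.toNNReal Y := by
  apply LipschitzWith.of_dist_le_mul
  intro s t
  rw [Real.coe_toNNReal d hd.le, Real.dist_eq, Real.dist_eq, ← abs_of_pos hd, ← abs_mul]
  apply sq_le_sq.1
  have := h.lip t s
  nlinarith [sq_nonneg (X s - X t)]

lemma CW.deriv_orth {d : ℝ} (hd : 0 < d) {S : Set (ℝ × ℝ)} {X Y : ℝ → ℝ} (h : CW d S X Y)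
    {t x' y' : ℝ} (hx : HasDerivAt X x' t) (hy : HasDerivAt Y y' t) :
    x' * Real.cos t + y' * Real.sin t = 0 := by
  have hmax : IsLocalMax (fun s => X s * Real.cos t + Y s * Real.sin t) t :=
    Filter.Eventually.of_forall fun s => h.support hd t s
  exact hmax.hasDerivAt_eq_zero ((hx.mul_const _).add (hy.mul_const _))

lemma CW.deriv_bound {d : ℝ} {S : Set (ℝ × ℝ)} {X Y : ℝ → ℝ} (h : CW d S X Y)
    {t x' y' : ℝ} (hx : HasDerivAt X x' t) (hy : HasDerivAt Y y' t) :
    x' ^ 2 + y' ^ 2 ≤ d * (x' * (-Real.sin t) + y' * Real.cos t) := by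
  have hX := hasDerivAt_iff_tendsto_slope.1 hx
  have hY := hasDerivAt_iff_tendsto_slope.1 hy
  have hC := hasDerivAt_iff_tendsto_slope.1 (Real.hasDerivAt_cos t)
  have hS := hasDerivAt_iff_tendsto_slope.1 (Real.hasDerivAt_sin t)
  refine le_of_tendsto_of_tendsto ((hX.pow 2).add (hY.pow 2))
    (((hX.mul hC).add (hY.mul hS)).const_mul d) ?_
  filter_upwards [self_mem_nhdsWithin] with s hs
  have hst : s - t ≠ 0 := sub_ne_zero.2 hs
  have h1 := h.mono t s
  simp only [slope_def_field]
  have h2 : 0 < (s - t) ^ 2 := by positivity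
  have e1 : ((X s - X t) / (s - t)) ^ 2 + ((Y s - Y t) / (s - t)) ^ 2
      = ((X s - X t) ^ 2 + (Y s - Y t) ^ 2) / (s - t) ^ 2 := by
    field_simp
  have e2 : d * ((X s - X t) / (s - t) * ((Real.cos s - Real.cos t) / (s - t))
      + (Y s - Y t) / (s - t) * ((Real.sin s - Real.sin t) / (s - t)))
      = d * ((X s - X t) * (Real.cos s - Real.cos t)
        + (Y s - Y t) * (Real.sin s - Real.sin t)) / (s - t) ^ 2 := by
    field_simp
  rw [e1, e2]
  exact div_le_div_of_nonneg_right h1 h2.le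

lemma CW.deriv_opp {d : ℝ} {S : Set (ℝ × ℝ)} {X Y : ℝ → ℝ} (h : CW d S X Y)
    {t x' y' : ℝ} (hx : HasDerivAt X x' t) (hy : HasDerivAt Y y' t) :
    HasDerivAt X (x' + d * Real.sin t) (t + Real.pi) ∧
    HasDerivAt Y (y' - d * Real.cos t) (t + Real.pi) := by
  have ht : t = t + Real.pi - Real.pi := by ring
  constructor
  · have e : X = fun s => X (s - Real.pi) - d * Real.cos (s - Real.pi) := by
      funext s
      rw [← h.oppX, sub_add_cancel]
    rw [e]
    have h1 : HasDerivAt (fun s => X s - d * Real.cos s) (x' - d * (-Real.sin t)) t :=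
      hx.sub ((Real.hasDerivAt_cos t).const_mul d)
    rw [ht] at h1
    have h2 := h1.comp_sub_const (t + Real.pi) Real.pi
    rw [← ht] at h2
    exact h2.congr_deriv (by ring)
  · have e : Y = fun s => Y (s - Real.pi) - d * Real.sin (s - Real.pi) := by
      funext s
      rw [← h.oppY, sub_add_cancel]
    rw [e]
    have h1 : HasDerivAt (fun s => Y s - d * Real.sin s) (y' - d * (Real.cos t)) t :=
      hy.sub ((Real.hasDerivAt_sin t).const_mul d)
    rw [ht] at h1
    have h2 := h1.comp_sub_const (t + Real.pi) Real.pi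
    rw [← ht] at h2
    exact h2

lemma CW.translate {d : ℝ} {S : Set (ℝ × ℝ)} {X Y : ℝ → ℝ} (h : CW d S X Y) (o : ℝ × ℝ) :
    CW d {c | c + o ∈ S} (fun t => X t - o.1) (fun t => Y t - o.2) where
  near t c hc := by
    have := h.near t _ hc
    simp only [Prod.fst_add, Prod.snd_add] at this
    linear_combination this
  diam t s := by linear_combination h.diam t s
  oppX t := by rw [h.oppX]; ring
  oppY t := by rw [h.oppY]; ring

/-- Support function. -/
noncomputable def supp (X Y : ℝ → ℝ) (t : ℝ) : ℝ := X t * Real.cos t + Y t * Real.sin t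

lemma CW.supp_opp {d : ℝ} {S : Set (ℝ × ℝ)} {X Y : ℝ → ℝ} (h : CW d S X Y) (t : ℝ) :
    supp X Y (t + Real.pi) = d - supp X Y t := by
  unfold supp
  rw [h.oppX, h.oppY, Real.cos_add_pi, Real.sin_add_pi]
  linear_combination d * Real.sin_sq_add_cos_sq t

lemma CW.supp_cont {d : ℝ} (hd : 0 < d) {S : Set (ℝ × ℝ)} {X Y : ℝ → ℝ} (h : CW d S X Y) :
    Continuous (supp X Y) :=
  ((h.lipX hd).continuous.mul Real.continuous_cos).add
    ((h.lipY hd).continuous.mul Real.continuous_sin)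

/-- Pal's lemma: a circumscribed regular hexagon. -/
lemma CW.exists_hex {d : ℝ} (hd : 0 < d) {S : Set (ℝ × ℝ)} {X Y : ℝ → ℝ} (h : CW d S X Y) :
    ∃ (t0 : ℝ) (o : ℝ × ℝ),
      supp (fun t => X t - o.1) (fun t => Y t - o.2) t0 = d / 2 ∧
      supp (fun t => X t - o.1) (fun t => Y t - o.2) (t0 + Real.pi / 3) = d / 2 ∧
      supp (fun t => X t - o.1) (fun t => Y t - o.2) (t0 + 2 * Real.pi / 3) = d / 2 := by
  let f : ℝ → ℝ := fun t => supp X Y t - supp X Y (t + Real.pi / 3)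
    + supp X Y (t + 2 * Real.pi / 3) - d / 2
  have hc := h.supp_cont hd
  have hf : Continuous f := by
    have h1 : Continuous fun t : ℝ => supp X Y (t + Real.pi / 3) := hc.comp (by fun_prop)
    have h2 : Continuous fun t : ℝ => supp X Y (t + 2 * Real.pi / 3) := hc.comp (by fun_prop)
    exact ((hc.sub h1).add h2).sub continuous_const
  have hanti : f (0 + Real.pi / 3) = - f 0 := by
    have e1 : (0 : ℝ) + Real.pi / 3 + Real.pi / 3 = 0 + 2 * Real.pi / 3 := by ring
    have e2 : (0 : ℝ) + Real.pi / 3 + 2 * Real.pi / 3 = 0 + Real.pi := by ring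
    simp only [f, e1, e2, h.supp_opp]
    ring
  obtain ⟨t0, ht0⟩ : ∃ t0, f t0 = 0 := by
    rcases le_total (f 0) 0 with h0 | h0
    · exact mem_range_of_exists_le_of_exists_ge hf ⟨0, h0⟩ ⟨_, by rw [hanti]; linarith⟩
    · exact mem_range_of_exists_le_of_exists_ge hf ⟨_, by rw [hanti]; linarith⟩ ⟨0, h0⟩
  have h3 : Real.sqrt 3 ^ 2 = 3 := Real.sq_sqrt (by norm_num)
  have h3p : Real.sqrt 3 ≠ 0 := by positivity
  have hcs := Real.sin_sq_add_cos_sq t0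
  have hco : ∀ o : ℝ × ℝ, ∀ t, supp (fun t => X t - o.1) (fun t => Y t - o.2) t
      = supp X Y t - (o.1 * Real.cos t + o.2 * Real.sin t) := by
    intro o t; unfold supp; ring
  obtain ⟨p, hp⟩ : ∃ p, p = supp X Y t0 - d / 2 := ⟨_, rfl⟩
  obtain ⟨q, hq⟩ : ∃ q, q = (2 * (supp X Y (t0 + Real.pi / 3) - d / 2) - p) / Real.sqrt 3 :=
    ⟨_, rfl⟩
  have hq' : Real.sqrt 3 * q = 2 * (supp X Y (t0 + Real.pi / 3) - d / 2) - p := by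
    rw [hq]; field_simp
  have c2 : Real.cos (2 * Real.pi / 3) = -1 / 2 := by
    rw [show 2 * Real.pi / 3 = Real.pi - Real.pi / 3 by ring, Real.cos_pi_sub, Real.cos_pi_div_three]
    ring
  have s2 : Real.sin (2 * Real.pi / 3) = Real.sqrt 3 / 2 := by
    rw [show 2 * Real.pi / 3 = Real.pi - Real.pi / 3 by ring, Real.sin_pi_sub, Real.sin_pi_div_three]
  have hf0 : supp X Y t0 - supp X Y (t0 + Real.pi / 3)
    + supp X Y (t0 + 2 * Real.pi / 3) - d / 2 = 0 := ht0
  refine ⟨t0, (p * Real.cos t0 - q * Real.sin t0, p * Real.sin t0 + q * Real.cos t0), ?_, ?_, ?_⟩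
  · rw [hco]
    simp only
    linear_combination -hp - p * hcs
  · rw [hco, Real.cos_add, Real.sin_add, Real.cos_pi_div_three, Real.sin_pi_div_three]
    simp only
    linear_combination (-(p / 2) - Real.sqrt 3 / 2 * q) * hcs - hq' / 2
  · rw [hco, Real.cos_add, Real.sin_add, c2, s2]
    simp only
    linear_combination hf0 + hp + (p / 2 - Real.sqrt 3 / 2 * q) * hcs - hq' / 2

lemma CW.hex_all {d : ℝ} {S : Set (ℝ × ℝ)} {X Y : ℝ → ℝ} (h : CW d S X Y)
    {t0 : ℝ} (h0 : supp X Y t0 = d / 2) (h1 : supp X Y (t0 + Real.pi / 3) = d / 2)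
    (h2 : supp X Y (t0 + 2 * Real.pi / 3) = d / 2) (k : ℕ) :
    supp X Y (t0 + k * (Real.pi / 3)) = d / 2 := by
  have : supp X Y (t0 + k * (Real.pi / 3)) = d / 2 ∧
      supp X Y (t0 + k * (Real.pi / 3) + Real.pi / 3) = d / 2 ∧
      supp X Y (t0 + k * (Real.pi / 3) + 2 * Real.pi / 3) = d / 2 := by
    induction k with
    | zero => simpa using ⟨h0, h1, h2⟩
    | succ k ih =>
      obtain ⟨a, b, c⟩ := ih
      have e0 : t0 + ((k + 1 : ℕ) : ℝ) * (Real.pi / 3) = t0 + k * (Real.pi / 3) + Real.pi / 3 := by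
        push_cast; ring
      rw [e0]
      refine ⟨b, ?_, ?_⟩
      · rw [← c]; congr 1; ring
      · rw [show t0 + k * (Real.pi / 3) + Real.pi / 3 + 2 * Real.pi / 3
          = t0 + k * (Real.pi / 3) + Real.pi by ring, h.supp_opp, a]
        ring
  exact this.1

lemma CW.hex_bound {d : ℝ} (hd : 0 < d) {S : Set (ℝ × ℝ)} {X Y : ℝ → ℝ} (h : CW d S X Y)
    {t0 : ℝ} (h0 : supp X Y t0 = d / 2) (h1 : supp X Y (t0 + Real.pi / 3) = d / 2)
    (h2 : supp X Y (t0 + 2 * Real.pi / 3) = d / 2) (k : ℕ) (ψ : ℝ) (hψ0 : 0 ≤ ψ)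
    (hψ1 : ψ ≤ Real.pi / 3) :
    supp X Y (t0 + k * (Real.pi / 3) + ψ) ≤ d / Real.sqrt 3 * Real.cos (ψ - Real.pi / 6) := by
  have hA := h.hex_all h0 h1 h2 k
  have hB := h.hex_all h0 h1 h2 (k + 1)
  have e0 : t0 + ((k + 1 : ℕ) : ℝ) * (Real.pi / 3) = t0 + k * (Real.pi / 3) + Real.pi / 3 := by
    push_cast; ring
  rw [e0] at hB
  generalize t0 + k * (Real.pi / 3) = a at *
  have hpi := Real.pi_pos
  have sA := h.support hd a (a + ψ)
  have sB := h.support hd (a + Real.pi / 3) (a + ψ)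
  have p1 : 0 ≤ Real.sin ψ := Real.sin_nonneg_of_nonneg_of_le_pi hψ0 (by linarith)
  have p2 : 0 ≤ Real.sin (Real.pi / 3 - ψ) :=
    Real.sin_nonneg_of_nonneg_of_le_pi (by linarith) (by linarith)
  change _ ≤ supp X Y a at sA
  change _ ≤ supp X Y (a + Real.pi / 3) at sB
  rw [hA] at sA
  rw [hB] at sB
  have m1 := mul_le_mul_of_nonneg_left sA p2
  have m2 := mul_le_mul_of_nonneg_left sB p1
  have h3 : Real.sqrt 3 ^ 2 = 3 := Real.sq_sqrt (by norm_num)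
  have h3p : 0 < Real.sqrt 3 := by positivity
  rw [Real.cos_add, Real.sin_add, Real.cos_pi_div_three, Real.sin_pi_div_three] at m2
  rw [Real.sin_sub, Real.cos_pi_div_three, Real.sin_pi_div_three] at m1
  rw [Real.cos_sub, Real.cos_pi_div_six, Real.sin_pi_div_six, div_mul_eq_mul_div, le_div_iff₀ h3p]
  unfold supp
  generalize X (a + ψ) = x at *
  generalize Y (a + ψ) = y at *
  rw [Real.cos_add a ψ, Real.sin_add a ψ]
  linear_combination 2 * m1 + 2 * m2

lemma CW.supp_le {d : ℝ} (hd : 0 < d) {S : Set (ℝ × ℝ)} {X Y : ℝ → ℝ} (h : CW d S X Y)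
    {t0 : ℝ} (h0 : supp X Y t0 = d / 2) (h1 : supp X Y (t0 + Real.pi / 3) = d / 2)
    (h2 : supp X Y (t0 + 2 * Real.pi / 3) = d / 2) (t : ℝ) (ht : t0 ≤ t) :
    supp X Y t < d := by
  have hpi := Real.pi_pos
  have hp3 : 0 < Real.pi / 3 := by positivity
  have f1 := Nat.floor_le (a := (t - t0) / (Real.pi / 3)) (div_nonneg (by linarith) hp3.le)
  have f2 := Nat.lt_floor_add_one ((t - t0) / (Real.pi / 3))
  rw [le_div_iff₀ hp3] at f1
  rw [div_lt_iff₀ hp3] at f2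
  have := h.hex_bound hd h0 h1 h2 ⌊(t - t0) / (Real.pi / 3)⌋₊
    (t - t0 - ⌊(t - t0) / (Real.pi / 3)⌋₊ * (Real.pi / 3)) (by linarith) (by linarith)
  have e : t0 + ⌊(t - t0) / (Real.pi / 3)⌋₊ * (Real.pi / 3)
    + (t - t0 - ⌊(t - t0) / (Real.pi / 3)⌋₊ * (Real.pi / 3)) = t := by ring
  rw [e] at this
  refine this.trans_lt ?_
  have h3p : 1 < Real.sqrt 3 := by
    rw [Real.lt_sqrt] <;> norm_num
  have h4 : d / Real.sqrt 3 < d := div_lt_self hd h3p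
  refine lt_of_le_of_lt ?_ h4
  exact mul_le_of_le_one_right (by positivity) (Real.cos_le_one _)

lemma CW.supp_pos {d : ℝ} (hd : 0 < d) {S : Set (ℝ × ℝ)} {X Y : ℝ → ℝ} (h : CW d S X Y)
    {t0 : ℝ} (h0 : supp X Y t0 = d / 2) (h1 : supp X Y (t0 + Real.pi / 3) = d / 2)
    (h2 : supp X Y (t0 + 2 * Real.pi / 3) = d / 2) (t : ℝ) (ht : t0 ≤ t) :
    0 < supp X Y t := by
  have := h.supp_le hd h0 h1 h2 (t + Real.pi) (by linarith [Real.pi_pos])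
  rw [h.supp_opp] at this
  linarith

lemma CW.zero_near {d : ℝ} (hd : 0 < d) (hd1 : d < 1) {S : Set (ℝ × ℝ)} {X Y : ℝ → ℝ}
    (h : CW d S X Y)
    {t0 : ℝ} (h0 : supp X Y t0 = d / 2) (h1 : supp X Y (t0 + Real.pi / 3) = d / 2)
    (h2 : supp X Y (t0 + 2 * Real.pi / 3) = d / 2) (c : ℝ × ℝ) (hc : c ∈ S) :
    sqd 0 c ≤ 1 := by
  have k0 := h.support_mem hd t0 c hc
  have k1 := h.support_mem hd (t0 + Real.pi / 3) c hc
  have k2 := h.support_mem hd (t0 + 2 * Real.pi / 3) c hc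
  have k3 := h.support_mem hd (t0 + Real.pi) c hc
  have k4 := h.support_mem hd (t0 + Real.pi / 3 + Real.pi) c hc
  have k5 := h.support_mem hd (t0 + 2 * Real.pi / 3 + Real.pi) c hc
  change _ ≤ supp X Y _ at k0 k1 k2 k3 k4 k5
  rw [h.supp_opp] at k3 k4 k5
  rw [h0] at k0 k3
  rw [h1] at k1 k4
  rw [h2] at k2 k5
  have c2 : Real.cos (2 * Real.pi / 3) = -1 / 2 := by
    rw [show 2 * Real.pi / 3 = Real.pi - Real.pi / 3 by ring, Real.cos_pi_sub, Real.cos_pi_div_three]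
    ring
  have s2 : Real.sin (2 * Real.pi / 3) = Real.sqrt 3 / 2 := by
    rw [show 2 * Real.pi / 3 = Real.pi - Real.pi / 3 by ring, Real.sin_pi_sub, Real.sin_pi_div_three]
  simp only [Real.cos_add, Real.sin_add, Real.cos_pi, Real.sin_pi, c2, s2, Real.cos_pi_div_three,
    Real.sin_pi_div_three] at k0 k1 k2 k3 k4 k5
  have h3 : Real.sqrt 3 ^ 2 = 3 := Real.sq_sqrt (by norm_num)
  have h3p : 0 < Real.sqrt 3 := by positivity
  have hcs := Real.sin_sq_add_cos_sq t0
  obtain ⟨p, hp⟩ : ∃ p, p = c.1 * Real.cos t0 + c.2 * Real.sin t0 := ⟨_, rfl⟩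
  obtain ⟨q, hq⟩ : ∃ q, q = Real.sqrt 3 * (-c.1 * Real.sin t0 + c.2 * Real.cos t0) := ⟨_, rfl⟩
  have a1 : p ^ 2 ≤ (d / 2) ^ 2 := sq_le_sq' (by rw [hp]; linarith) (by rw [hp]; linarith)
  have a2 : q ^ 2 ≤ d ^ 2 := sq_le_sq' (by rw [hq]; linarith) (by rw [hq]; linarith)
  have a3 : sqd 0 c = p ^ 2 + q ^ 2 / 3 := by
    simp only [sqd, hp, hq, Prod.fst_zero, Prod.snd_zero]
    linear_combination (-(c.1 ^ 2 + c.2 ^ 2)) * hcs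
      - (-c.1 * Real.sin t0 + c.2 * Real.cos t0) ^ 2 / 3 * h3
  rw [a3]
  nlinarith

/-- The area density. -/
noncomputable def dens (d : ℝ) (X Y : ℝ → ℝ) (t : ℝ) : ℝ :=
  (supp X Y t + (1 - d)) * (deriv X t * (-Real.sin t) + deriv Y t * Real.cos t + (1 - d))

lemma CW.dens_nonneg {d : ℝ} (hd : 0 < d) (hd1 : d < 1) {S : Set (ℝ × ℝ)} {X Y : ℝ → ℝ}
    (h : CW d S X Y) {t : ℝ} (hp : 0 < supp X Y t) (hx : DifferentiableAt ℝ X t)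
    (hy : DifferentiableAt ℝ Y t) : 0 ≤ dens d X Y t := by
  have h1 := h.deriv_bound hx.hasDerivAt hy.hasDerivAt
  unfold dens
  have h2 : 0 ≤ deriv X t * (-Real.sin t) + deriv Y t * Real.cos t := by
    by_contra hn
    push Not at hn
    have := mul_neg_of_pos_of_neg hd hn
    nlinarith [sq_nonneg (deriv X t), sq_nonneg (deriv Y t)]
  exact mul_nonneg (by linarith) (by linarith)

lemma CW.dens_pair {d : ℝ} (hd : 0 < d) {S : Set (ℝ × ℝ)} {X Y : ℝ → ℝ}
    (h : CW d S X Y) {t M : ℝ} (hx : DifferentiableAt ℝ X t)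
    (hy : DifferentiableAt ℝ Y t) (hM1 : supp X Y t ≤ M)
    (hM2 : supp X Y (t + Real.pi) ≤ M) :
    d * (d - M) + 2 * (1 - d) * d + 2 * (1 - d) ^ 2 ≤
      dens d X Y t + dens d X Y (t + Real.pi) := by
  have h1 := h.deriv_bound hx.hasDerivAt hy.hasDerivAt
  have h2 := h.deriv_orth hd hx.hasDerivAt hy.hasDerivAt
  obtain ⟨h3, h4⟩ := h.deriv_opp hx.hasDerivAt hy.hasDerivAt
  have hcs := Real.sin_sq_add_cos_sq t
  unfold dens
  rw [h3.deriv, h4.deriv]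
  rw [h.supp_opp] at hM2 ⊢
  rw [Real.cos_add_pi, Real.sin_add_pi]
  generalize deriv X t = x' at *
  generalize deriv Y t = y' at *
  obtain ⟨ρ, hρ⟩ : ∃ ρ, ρ = x' * (-Real.sin t) + y' * Real.cos t := ⟨_, rfl⟩
  have ex : x' = -ρ * Real.sin t := by
    rw [hρ]; linear_combination Real.cos t * h2 - x' * hcs
  have ey : y' = ρ * Real.cos t := by
    rw [hρ]; linear_combination Real.sin t * h2 - y' * hcs
  have e1 : (x' + d * Real.sin t) * (- -Real.sin t) + (y' - d * Real.cos t) * (-Real.cos t)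
      = d - ρ := by
    rw [hρ]; linear_combination d * hcs
  rw [e1, ← hρ]
  rw [← hρ] at h1
  have hn : x' ^ 2 + y' ^ 2 = ρ ^ 2 := by
    rw [ex, ey]; linear_combination ρ ^ 2 * hcs
  rw [hn] at h1
  have r0 : 0 ≤ ρ := by
    by_contra hneg
    push Not at hneg
    nlinarith [mul_neg_of_pos_of_neg hd hneg, sq_nonneg ρ]
  have r1 : ρ ≤ d := by
    by_contra hneg
    push Not at hneg
    nlinarith
  have a1 := mul_nonneg r0 (by linarith : 0 ≤ M - (d - supp X Y t))
  have a2 := mul_nonneg (by linarith : 0 ≤ d - ρ) (by linarith : 0 ≤ M - supp X Y t)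
  nlinarith

lemma CW.ae_diff {d : ℝ} (hd : 0 < d) {S : Set (ℝ × ℝ)} {X Y : ℝ → ℝ} (h : CW d S X Y) :
    ∀ᵐ t : ℝ, DifferentiableAt ℝ X t ∧ DifferentiableAt ℝ Y t :=
  (h.lipX hd).ae_differentiableAt_real.and (h.lipY hd).ae_differentiableAt_real

lemma lip_deriv_intervalIntegrable {K : NNReal} {f : ℝ → ℝ} (hf : LipschitzWith K f) (a b : ℝ) :
    IntervalIntegrable (deriv f) volume a b := by
  have hc : IntervalIntegrable (fun _ : ℝ => (K : ℝ)) volume a b := intervalIntegrable_const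
  refine hc.mono_fun (measurable_deriv f).aestronglyMeasurable ?_
  refine Filter.Eventually.of_forall fun t => ?_
  have := norm_deriv_le_of_lipschitz (x₀ := t) hf
  simpa using this

lemma CW.dens_integrable {d : ℝ} (hd : 0 < d) {S : Set (ℝ × ℝ)} {X Y : ℝ → ℝ}
    (h : CW d S X Y) (a b : ℝ) : IntervalIntegrable (dens d X Y) volume a b := by
  have hX := lip_deriv_intervalIntegrable (h.lipX hd) a b
  have hY := lip_deriv_intervalIntegrable (h.lipY hd) a b
  have h1 : IntervalIntegrable
      (fun t => deriv X t * (-Real.sin t) + deriv Y t * Real.cos t + (1 - d)) volume a b :=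
    ((hX.mul_continuousOn (by fun_prop)).add (hY.mul_continuousOn (by fun_prop))).add
      intervalIntegrable_const
  exact h1.continuousOn_mul ((h.supp_cont hd).add continuous_const).continuousOn

lemma CW.dens_integral {d : ℝ} (hd : 0 < d) {S : Set (ℝ × ℝ)} {X Y : ℝ → ℝ}
    (h : CW d S X Y)
    {t0 : ℝ} (h0 : supp X Y t0 = d / 2) (h1 : supp X Y (t0 + Real.pi / 3) = d / 2)
    (h2 : supp X Y (t0 + 2 * Real.pi / 3) = d / 2) :
    2 * (1 / 2 * (Real.pi - Real.sqrt 3) * d ^ 2 - Real.pi * d + Real.pi) ≤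
      ∫ t in t0..(t0 + 2 * Real.pi), dens d X Y t := by
  have hp3 : 0 ≤ Real.pi / 3 := by positivity
  let J : ℕ → ℝ := fun k => ∫ ψ in (0 : ℝ)..(Real.pi / 3), dens d X Y (t0 + k * (Real.pi / 3) + ψ)
  have hJ : ∀ k : ℕ, J k = ∫ t in (t0 + k * (Real.pi / 3))..(t0 + (k + 1 : ℕ) * (Real.pi / 3)),
      dens d X Y t := by
    intro k
    simp only [J]
    rw [intervalIntegral.integral_comp_add_left (fun t => dens d X Y t)]
    congr 1
    · ring
    · push_cast; ring
  have hsum : ∫ t in t0..(t0 + 2 * Real.pi), dens d X Y t = ∑ k ∈ Finset.range 6, J k := by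
    rw [Finset.sum_congr rfl (fun k _ => hJ k),
      intervalIntegral.sum_integral_adjacent_intervals
        (a := fun k : ℕ => t0 + k * (Real.pi / 3)) (fun k _ => h.dens_integrable hd _ _)]
    congr 1
    · simp
    · push_cast; ring
  have hint : ∀ a, IntervalIntegrable (fun ψ => dens d X Y (a + ψ)) volume 0 (Real.pi / 3) := by
    intro a
    have := (h.dens_integrable hd (a + 0) (a + Real.pi / 3)).comp_add_left a
    simpa using this
  have hpair : ∀ k : ℕ, (Real.pi / 3) * (d ^ 2 + 2 * (1 - d) * d + 2 * (1 - d) ^ 2)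
      - d ^ 2 / Real.sqrt 3 ≤ J k + J (k + 3) := by
    intro k
    simp only [J]
    rw [← intervalIntegral.integral_add (hint _) (hint _)]
    have hval : ∫ ψ in (0 : ℝ)..(Real.pi / 3),
        ((d ^ 2 + 2 * (1 - d) * d + 2 * (1 - d) ^ 2)
          - d ^ 2 / Real.sqrt 3 * Real.cos (ψ - Real.pi / 6))
        = (Real.pi / 3) * (d ^ 2 + 2 * (1 - d) * d + 2 * (1 - d) ^ 2)
          - d ^ 2 / Real.sqrt 3 := by
      rw [intervalIntegral.integral_sub (by simp) (Continuous.intervalIntegrable (by fun_prop) _ _),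
        intervalIntegral.integral_const, intervalIntegral.integral_const_mul,
        intervalIntegral.integral_comp_sub_right (fun x => Real.cos x), integral_cos,
        show Real.pi / 3 - Real.pi / 6 = Real.pi / 6 by ring, zero_sub, Real.sin_neg,
        Real.sin_pi_div_six]
      simp only [smul_eq_mul]
      ring
    rw [← hval]
    refine intervalIntegral.integral_mono_ae_restrict hp3
      (Continuous.intervalIntegrable (by fun_prop) _ _) ((hint _).add (hint _)) ?_
    have hae : ∀ᵐ ψ : ℝ, DifferentiableAt ℝ X (t0 + k * (Real.pi / 3) + ψ) ∧
        DifferentiableAt ℝ Y (t0 + k * (Real.pi / 3) + ψ) :=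
      (measurePreserving_add_left volume (t0 + k * (Real.pi / 3))).quasiMeasurePreserving.ae
        (h.ae_diff hd)
    filter_upwards [ae_restrict_of_ae hae, ae_restrict_mem measurableSet_Icc] with ψ hψ hI
    have e : t0 + ((k + 3 : ℕ) : ℝ) * (Real.pi / 3) + ψ
        = t0 + k * (Real.pi / 3) + ψ + Real.pi := by
      push_cast; ring
    have b1 := h.hex_bound hd h0 h1 h2 k ψ hI.1 hI.2
    have b2 := h.hex_bound hd h0 h1 h2 (k + 3) ψ hI.1 hI.2
    rw [e] at b2 ⊢
    have := h.dens_pair hd hψ.1 hψ.2 b1 b2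
    refine le_trans (le_of_eq ?_) this
    ring
  have p0 := hpair 0
  have p1 := hpair 1
  have p2 := hpair 2
  rw [hsum]
  simp only [Finset.sum_range_succ, Finset.sum_range_zero]
  norm_num at p0 p1 p2
  have h3 : d ^ 2 / Real.sqrt 3 = d ^ 2 * Real.sqrt 3 / 3 := by
    have h3 : Real.sqrt 3 ^ 2 = 3 := Real.sq_sqrt (by norm_num)
    have h3p : Real.sqrt 3 ≠ 0 := by positivity
    field_simp
    rw [h3]
  rw [h3] at p0 p1 p2
  linarith

/-- Boundary of the outer parallel body, first coordinate. -/
noncomputable def bX (d : ℝ) (X : ℝ → ℝ) (t : ℝ) : ℝ := X t + (1 - d) * Real.cos t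

/-- Boundary of the outer parallel body, second coordinate. -/
noncomputable def bY (d : ℝ) (Y : ℝ → ℝ) (t : ℝ) : ℝ := Y t + (1 - d) * Real.sin t

/-- Generalised polar coordinates. -/
noncomputable def polF (d : ℝ) (X Y : ℝ → ℝ) (p : ℝ × ℝ) : ℝ × ℝ :=
  (p.1 * bX d X p.2, p.1 * bY d Y p.2)

/-- Derivative of `polF`. -/
noncomputable def polF' (d : ℝ) (X Y : ℝ → ℝ) (p : ℝ × ℝ) : ℝ × ℝ →L[ℝ] ℝ × ℝ :=
  (Matrix.toLin (.finTwoProd ℝ) (.finTwoProd ℝ)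
    !![bX d X p.2, p.1 * (deriv X p.2 - (1 - d) * Real.sin p.2);
       bY d Y p.2, p.1 * (deriv Y p.2 + (1 - d) * Real.cos p.2)]).toContinuousLinearMap

lemma hasFDerivAt_polF (d : ℝ) (X Y : ℝ → ℝ) (p : ℝ × ℝ) (hx : DifferentiableAt ℝ X p.2)
    (hy : DifferentiableAt ℝ Y p.2) : HasFDerivAt (polF d X Y) (polF' d X Y p) p := by
  unfold polF'
  rw [Matrix.toLin_finTwoProd_toContinuousLinearMap]
  have h1 : HasDerivAt (bX d X) (deriv X p.2 + (1 - d) * (-Real.sin p.2)) p.2 :=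
    hx.hasDerivAt.add ((Real.hasDerivAt_cos p.2).const_mul _)
  have h2 : HasDerivAt (bY d Y) (deriv Y p.2 + (1 - d) * (Real.cos p.2)) p.2 :=
    hy.hasDerivAt.add ((Real.hasDerivAt_sin p.2).const_mul _)
  refine (HasFDerivAt.prodMk (𝕜 := ℝ)
      (hasFDerivAt_fst.mul (h1.comp_hasFDerivAt p hasFDerivAt_snd))
      (hasFDerivAt_fst.mul (h2.comp_hasFDerivAt p hasFDerivAt_snd))).congr_fderiv ?_
  ext <;> simp <;> left <;> ring

lemma det_polF' (d : ℝ) (X Y : ℝ → ℝ) (p : ℝ × ℝ) :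
    (polF' d X Y p).det = p.1 * (bX d X p.2 * (deriv Y p.2 + (1 - d) * Real.cos p.2)
      - bY d Y p.2 * (deriv X p.2 - (1 - d) * Real.sin p.2)) := by
  unfold polF'
  simp only [LinearMap.det_toContinuousLinearMap, LinearMap.det_toLin, Matrix.det_fin_two_of]
  ring

lemma CW.det_eq {d : ℝ} (hd : 0 < d) {S : Set (ℝ × ℝ)} {X Y : ℝ → ℝ}
    (h : CW d S X Y) (p : ℝ × ℝ) (hx : DifferentiableAt ℝ X p.2)
    (hy : DifferentiableAt ℝ Y p.2) : (polF' d X Y p).det = p.1 * dens d X Y p.2 := by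
  rw [det_polF']
  have h2 := h.deriv_orth hd hx.hasDerivAt hy.hasDerivAt
  have hcs := Real.sin_sq_add_cos_sq p.2
  unfold bX bY dens supp
  generalize deriv X p.2 = x' at *
  generalize deriv Y p.2 = y' at *
  generalize X p.2 = x at *
  generalize Y p.2 = y at *
  generalize Real.cos p.2 = c at *
  generalize Real.sin p.2 = s at *
  have ex : x' = -(x' * (-s) + y' * c) * s := by
    linear_combination c * h2 - x' * hcs
  have ey : y' = (x' * (-s) + y' * c) * c := by
    linear_combination s * h2 - y' * hcs
  generalize x' * (-s) + y' * c = ρ at *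
  rw [ex, ey]
  linear_combination p.1 * (1 - d) * (ρ + (1 - d)) * hcs

lemma CW.b_support {d : ℝ} (hd : 0 < d) (hd1 : d < 1) {S : Set (ℝ × ℝ)} {X Y : ℝ → ℝ}
    (h : CW d S X Y) (t s : ℝ) :
    bX d X s * Real.cos t + bY d Y s * Real.sin t ≤
      supp X Y t + (1 - d) * Real.cos (s - t) := by
  have := h.support hd t s
  unfold bX bY supp
  rw [Real.cos_sub]
  linarith

lemma CW.b_near {d : ℝ} (hd : 0 < d) (hd1 : d < 1) {S : Set (ℝ × ℝ)} {X Y : ℝ → ℝ}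
    (h : CW d S X Y) (t : ℝ) (c : ℝ × ℝ) (hc : c ∈ S) :
    sqd (bX d X t, bY d Y t) c ≤ 1 ∧ (sqd (bX d X t, bY d Y t) c = 1 →
      c = (X (t + Real.pi), Y (t + Real.pi))) := by
  have h1 := h.near t c hc
  have hcs := Real.sin_sq_add_cos_sq t
  obtain ⟨p, hp⟩ : ∃ p, p = (X t - c.1) * Real.cos t + (Y t - c.2) * Real.sin t := ⟨_, rfl⟩
  obtain ⟨q, hq⟩ : ∃ q, q = -(X t - c.1) * Real.sin t + (Y t - c.2) * Real.cos t := ⟨_, rfl⟩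
  have e1 : (X t - c.1) ^ 2 + (Y t - c.2) ^ 2 = p ^ 2 + q ^ 2 := by
    rw [hp, hq]
    linear_combination (-((X t - c.1) ^ 2 + (Y t - c.2) ^ 2)) * hcs
  rw [e1] at h1
  have hpd : p ≤ d := (abs_le_of_sq_le_sq' (by nlinarith [sq_nonneg q]) hd.le).2
  have e2 : sqd (bX d X t, bY d Y t) c = p ^ 2 + q ^ 2 + 2 * (1 - d) * p + (1 - d) ^ 2 := by
    rw [← e1, hp]
    simp only [sqd, bX, bY]
    linear_combination (1 - d) ^ 2 * hcs
  rw [e2]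
  have h3 := mul_nonneg (sub_nonneg.2 hd1.le) (sub_nonneg.2 hpd)
  refine ⟨by nlinarith, fun heq => ?_⟩
  have hpe : p = d := by
    have h4 : (1 - d) * (d - p) = 0 := by nlinarith
    rcases mul_eq_zero.1 h4 with h5 | h5 <;> linarith
  have hqe : q = 0 := by
    rw [hpe] at h1
    nlinarith [sq_nonneg q]
  rw [h.oppX, h.oppY]
  ext
  · simp only
    linear_combination (X t - c.1) * hcs - Real.cos t * (hpe - hp) - Real.sin t * (hq - hqe)
  · simp only
    linear_combination (Y t - c.2) * hcs - Real.sin t * (hpe - hp) + Real.cos t * (hq - hqe)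

/-- The parameter domain. -/
def polDom (X Y : ℝ → ℝ) (t0 : ℝ) : Set ℝ :=
  Set.Ioo t0 (t0 + 2 * Real.pi) ∩ ({t | DifferentiableAt ℝ X t} ∩ {t | DifferentiableAt ℝ Y t})

lemma polDom_meas (X Y : ℝ → ℝ) (t0 : ℝ) : MeasurableSet (polDom X Y t0) :=
  measurableSet_Ioo.inter
    ((measurableSet_of_differentiableAt ℝ X).inter (measurableSet_of_differentiableAt ℝ Y))

lemma CW.inj {d : ℝ} (hd : 0 < d) (hd1 : d < 1) {S : Set (ℝ × ℝ)} {X Y : ℝ → ℝ}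
    (h : CW d S X Y) {t0 : ℝ} (hpos : ∀ t, t0 ≤ t → 0 < supp X Y t) :
    Set.InjOn (polF d X Y) (Set.Ioo (0 : ℝ) 1 ×ˢ polDom X Y t0) := by
  have aux : ∀ r s t t' : ℝ, 0 < r → 0 < s → t0 ≤ t → r * bX d X t = s * bX d X t' →
      r * bY d Y t = s * bY d Y t' → r ≤ s ∧ (r = s → Real.cos (t' - t) = 1) := by
    intro r s t t' hr hs ht e1 e2
    have hb := h.b_support hd hd1 t t'
    have hc1 := Real.cos_le_one (t' - t)
    have hP := hpos t ht
    have heq : r * (supp X Y t + (1 - d)) =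
        s * (bX d X t' * Real.cos t + bY d Y t' * Real.sin t) := by
      have : bX d X t * Real.cos t + bY d Y t * Real.sin t = supp X Y t + (1 - d) := by
        unfold bX bY supp
        linear_combination (1 - d) * Real.sin_sq_add_cos_sq t
      rw [← this]
      linear_combination Real.cos t * e1 + Real.sin t * e2
    have hm := mul_le_mul_of_nonneg_left hb hs.le
    have hc2 : (1 - d) * Real.cos (t' - t) ≤ 1 - d := by nlinarith
    constructor
    · have hm2 := mul_le_mul_of_nonneg_left hc2 hs.le
      have : r * (supp X Y t + (1 - d)) ≤ s * (supp X Y t + (1 - d)) := by nlinarith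
      exact le_of_mul_le_mul_right this (by linarith)
    · intro hrs
      rw [hrs] at heq
      have : s * (supp X Y t + (1 - d)) ≤ s * (supp X Y t + (1 - d) * Real.cos (t' - t)) := by
        linarith
      have := le_of_mul_le_mul_left this hs
      have : (1 - d) * 1 ≤ (1 - d) * Real.cos (t' - t) := by linarith
      have := le_of_mul_le_mul_left this (by linarith)
      linarith
  rintro ⟨r, t⟩ ⟨hr, ht⟩ ⟨s, t'⟩ ⟨hs, ht'⟩ heq
  simp only [polF, Prod.mk.injEq] at heq hr hs ht ht'
  obtain ⟨e1, e2⟩ := heq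
  obtain ⟨a1, a2⟩ := aux r s t t' hr.1 hs.1 ht.1.1.le e1 e2
  obtain ⟨b1, b2⟩ := aux s r t' t hs.1 hr.1 ht'.1.1.le e1.symm e2.symm
  have hrs : r = s := le_antisymm a1 b1
  have hcos := a2 hrs
  have htt := (Real.cos_eq_one_iff_of_lt_of_lt (by linarith [ht.1.1, ht.1.2, ht'.1.1, ht'.1.2])
    (by linarith [ht.1.1, ht.1.2, ht'.1.1, ht'.1.2])).1 hcos
  ext
  · exact hrs
  · simp only; linarith

lemma CW.image_volume {d : ℝ} (hd : 0 < d) (hd1 : d < 1) {S : Set (ℝ × ℝ)} {X Y : ℝ → ℝ}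
    (h : CW d S X Y) {t0 : ℝ} (hpos : ∀ t, t0 ≤ t → 0 < supp X Y t) :
    volume (polF d X Y '' (Set.Ioo (0 : ℝ) 1 ×ˢ polDom X Y t0)) =
      ENNReal.ofReal (1 / 2 * ∫ t in t0..(t0 + 2 * Real.pi), dens d X Y t) := by
  have hm : MeasurableSet (Set.Ioo (0 : ℝ) 1 ×ˢ polDom X Y t0) :=
    measurableSet_Ioo.prod (polDom_meas X Y t0)
  have hmeas : Measurable (dens d X Y) := by
    have h1 := (h.supp_cont hd).measurable
    have h2 := measurable_deriv X
    have h3 := measurable_deriv Y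
    unfold dens
    fun_prop
  rw [← lintegral_abs_det_fderiv_eq_addHaar_image volume hm
    (fun p hp => (hasFDerivAt_polF d X Y p hp.2.2.1 hp.2.2.2).hasFDerivWithinAt)
    (h.inj hd hd1 hpos)]
  have hnn : ∀ t ∈ polDom X Y t0, 0 ≤ dens d X Y t := fun t ht =>
    h.dens_nonneg hd hd1 (hpos t ht.1.1.le) ht.2.1 ht.2.2
  have e1 : ∫⁻ p in Set.Ioo (0 : ℝ) 1 ×ˢ polDom X Y t0, ENNReal.ofReal |(polF' d X Y p).det|
      = ∫⁻ p in Set.Ioo (0 : ℝ) 1 ×ˢ polDom X Y t0,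
        ENNReal.ofReal p.1 * ENNReal.ofReal (dens d X Y p.2) := by
    refine setLIntegral_congr_fun hm fun p hp => ?_
    rw [h.det_eq hd p hp.2.2.1 hp.2.2.2, abs_of_nonneg (mul_nonneg hp.1.1.le (hnn _ hp.2)),
      ENNReal.ofReal_mul hp.1.1.le]
  rw [e1, Measure.volume_eq_prod, ← Measure.prod_restrict,
    lintegral_prod_mul (f := fun r : ℝ => ENNReal.ofReal r)
      (g := fun t => ENNReal.ofReal (dens d X Y t)) (by fun_prop) (by fun_prop)]
  have hae : polDom X Y t0 =ᵐ[volume] Set.Ioc t0 (t0 + 2 * Real.pi) := by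
    refine Filter.EventuallyEq.trans ?_ Ioo_ae_eq_Ioc
    have := h.ae_diff hd
    filter_upwards [this] with t ht
    apply propext
    exact ⟨fun hh => hh.1, fun hh => ⟨hh, ht.1, ht.2⟩⟩
  have e2 : ∫⁻ r in Set.Ioo (0 : ℝ) 1, ENNReal.ofReal r = ENNReal.ofReal (1 / 2) := by
    rw [← ofReal_integral_eq_lintegral_ofReal]
    · rw [← integral_Ioc_eq_integral_Ioo, ← intervalIntegral.integral_of_le zero_le_one,
        integral_id]
      norm_num
    · exact (continuous_id.integrableOn_Icc (a := (0 : ℝ)) (b := 1)).mono_set Set.Ioo_subset_Icc_self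
    · filter_upwards [ae_restrict_mem measurableSet_Ioo] with r hr using hr.1.le
  have e3 : ∫⁻ t in polDom X Y t0, ENNReal.ofReal (dens d X Y t) =
      ENNReal.ofReal (∫ t in t0..(t0 + 2 * Real.pi), dens d X Y t) := by
    have hle : t0 ≤ t0 + 2 * Real.pi := by linarith [Real.pi_pos]
    rw [intervalIntegral.integral_of_le hle, ← setIntegral_congr_set hae,
      ofReal_integral_eq_lintegral_ofReal]
    · exact ((h.dens_integrable hd t0 (t0 + 2 * Real.pi)).1).congr_set_ae hae
    · filter_upwards [ae_restrict_mem (polDom_meas X Y t0)] with t ht using hnn t ht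
  rw [e2, e3, ← ENNReal.ofReal_mul (by norm_num)]

lemma CW.exists_slack {d : ℝ} (hd : 0 < d) (hd1 : d < 1) {S : Set (ℝ × ℝ)} (hfin : S.Finite)
    {X Y : ℝ → ℝ} (h : CW d S X Y) (t0 : ℝ) :
    ∃ t, t0 ≤ t ∧ ∀ c ∈ S, sqd (bX d X t, bY d Y t) c < 1 := by
  by_contra hcon
  push Not at hcon
  have hsub : (fun t => (X (t + Real.pi), Y (t + Real.pi))) '' Set.Ici t0 ⊆ S := by
    rintro _ ⟨t, ht, rfl⟩
    obtain ⟨c, hc, hge⟩ := hcon t ht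
    obtain ⟨h1, h2⟩ := h.b_near hd hd1 t c hc
    simp only
    rw [← h2 (le_antisymm h1 hge)]
    exact hc
  have hX := (h.lipX hd).continuous
  have hY := (h.lipY hd).continuous
  have hcont : Continuous (fun t => (X (t + Real.pi), Y (t + Real.pi))) := by fun_prop
  have hpre := (isPreconnected_Ici (a := t0)).image _ hcont.continuousOn
  have hss := hfin.countable.isTotallyDisconnected _ hsub hpre
  have heq := hss ⟨t0, Set.self_mem_Ici, rfl⟩
    ⟨t0 + Real.pi, Set.mem_Ici.2 (by linarith [Real.pi_pos]), rfl⟩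
  simp only [Prod.mk.injEq] at heq
  rw [h.oppX (t0 + Real.pi), h.oppY (t0 + Real.pi)] at heq
  have hc0 : Real.cos (t0 + Real.pi) = 0 := by
    have : d * Real.cos (t0 + Real.pi) = 0 := by linarith [heq.1]
    exact (mul_eq_zero.1 this).resolve_left hd.ne'
  have hs0 : Real.sin (t0 + Real.pi) = 0 := by
    have : d * Real.sin (t0 + Real.pi) = 0 := by linarith [heq.2]
    exact (mul_eq_zero.1 this).resolve_left hd.ne'
  have := Real.sin_sq_add_cos_sq (t0 + Real.pi)
  rw [hc0, hs0] at this
  norm_num at this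

lemma CW.area_hex {d : ℝ} (hd : 0 < d) (hd1 : d < 1) {S : Set (ℝ × ℝ)} (hfin : S.Finite)
    {X Y : ℝ → ℝ} (h : CW d S X Y)
    {t0 : ℝ} (h0 : supp X Y t0 = d / 2) (h1 : supp X Y (t0 + Real.pi / 3) = d / 2)
    (h2 : supp X Y (t0 + 2 * Real.pi / 3) = d / 2) :
    ENNReal.ofReal (1 / 2 * (Real.pi - Real.sqrt 3) * d ^ 2 - Real.pi * d + Real.pi) <
      volume {z : ℝ × ℝ | ∀ c ∈ S, sqd z c ≤ 1} := by
  have hpos := h.supp_pos hd h0 h1 h2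
  have hvol := h.image_volume hd hd1 hpos
  have hint := h.dens_integral hd h0 h1 h2
  obtain ⟨t, ht, hslack⟩ := h.exists_slack hd hd1 hfin t0
  have hzero := h.zero_near hd hd1 h0 h1 h2
  set I := polF d X Y '' (Set.Ioo (0 : ℝ) 1 ×ˢ polDom X Y t0) with hI
  let O1 : Set (ℝ × ℝ) := ⋂ c ∈ S, {z | sqd z c < 1}
  let O2 : Set (ℝ × ℝ) := {z | supp X Y t + (1 - d) < z.1 * Real.cos t + z.2 * Real.sin t}
  have hO1 : IsOpen O1 := hfin.isOpen_biInter fun c _ =>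
    isOpen_lt (sqd_continuous c) continuous_const
  have hO2 : IsOpen O2 := isOpen_lt continuous_const (by fun_prop)
  have hne : (O1 ∩ O2).Nonempty := by
    let γ : ℝ → ℝ × ℝ := fun δ => (bX d X t + δ * Real.cos t, bY d Y t + δ * Real.sin t)
    have hγ : Continuous γ := by fun_prop
    have hmem : γ 0 ∈ O1 := by
      simp only [O1, γ, Set.mem_iInter, zero_mul, add_zero]
      exact fun c hc => hslack c hc
    have hev : ∀ᶠ δ in nhds (0 : ℝ), γ δ ∈ O1 := hγ.continuousAt.eventually_mem (hO1.mem_nhds hmem)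
    obtain ⟨ε, hε, hball⟩ := Metric.eventually_nhds_iff.1 hev
    refine ⟨γ (ε / 2), hball ?_, ?_⟩
    · rw [Real.dist_eq, sub_zero, abs_of_pos (by linarith)]; linarith
    · change supp X Y t + (1 - d) < (bX d X t + ε / 2 * Real.cos t) * Real.cos t
        + (bY d Y t + ε / 2 * Real.sin t) * Real.sin t
      have := Real.sin_sq_add_cos_sq t
      unfold supp bX bY
      nlinarith
  have hOpos : 0 < volume (O1 ∩ O2) := (hO1.inter hO2).measure_pos volume hne
  have hIsub : I ⊆ {z : ℝ × ℝ | ∀ c ∈ S, sqd z c ≤ 1} := by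
    rintro _ ⟨⟨r, s⟩, ⟨hr, hs⟩, rfl⟩ c hc
    have k1 := hzero c hc
    have k2 := (h.b_near hd hd1 s c hc).1
    simp only [polF, sqd, Prod.fst_zero, Prod.snd_zero] at k1 k2 hr ⊢
    have m1 := mul_le_mul_of_nonneg_left k2 hr.1.le
    have m2 := mul_le_mul_of_nonneg_left k1 (sub_nonneg.2 hr.2.le)
    have m3 := mul_nonneg (mul_nonneg hr.1.le (sub_nonneg.2 hr.2.le))
      (add_nonneg (sq_nonneg (bX d X s)) (sq_nonneg (bY d Y s)))
    linear_combination m1 + m2 + m3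
  have hdisj : Disjoint I (O1 ∩ O2) := by
    rw [Set.disjoint_left]
    rintro _ ⟨⟨r, s⟩, ⟨hr, hs⟩, rfl⟩ ⟨_, hz⟩
    have hz' : supp X Y t + (1 - d) < r * bX d X s * Real.cos t + r * bY d Y s * Real.sin t := hz
    have k := h.b_support hd hd1 t s
    have hP := hpos t ht
    have hc2 : (1 - d) * Real.cos (s - t) ≤ 1 - d := by nlinarith [Real.cos_le_one (s - t)]
    have hr1 : 0 < r ∧ r < 1 := hr
    have m1 := mul_le_mul_of_nonneg_left (k.trans (add_le_add_right hc2 (supp X Y t))) hr1.1.le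
    have m2 : r * (supp X Y t + (1 - d)) ≤ supp X Y t + (1 - d) :=
      mul_le_of_le_one_left (by linarith) hr1.2.le
    linarith
  have hsub : I ∪ (O1 ∩ O2) ⊆ {z : ℝ × ℝ | ∀ c ∈ S, sqd z c ≤ 1} := by
    apply Set.union_subset hIsub
    rintro z ⟨hz, _⟩ c hc
    simp only [O1, Set.mem_iInter] at hz
    exact le_of_lt (hz c hc)
  have hm := measure_mono (μ := volume) hsub
  rw [measure_union hdisj (hO1.inter hO2).measurableSet, hvol] at hm
  refine lt_of_lt_of_le ?_ hm
  refine lt_of_le_of_lt (ENNReal.ofReal_le_ofReal (by linarith :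
    _ ≤ 1 / 2 * ∫ t in t0..(t0 + 2 * Real.pi), dens d X Y t)) ?_
  exact ENNReal.lt_add_right ENNReal.ofReal_ne_top hOpos.ne'

lemma area_prod (d : ℝ) (hd : 0 < d) (hd1 : d < 1) (S : Set (ℝ × ℝ)) (hfin : S.Finite)
    (hne : S.Nonempty) (hS : ∀ p ∈ S, ∀ q ∈ S, sqd p q ≤ d ^ 2) :
    ENNReal.ofReal (1 / 2 * (Real.pi - Real.sqrt 3) * d ^ 2 - Real.pi * d + Real.pi) <
      volume {z : ℝ × ℝ | ∀ c ∈ S, sqd z c ≤ 1} := by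
  obtain ⟨X, Y, h⟩ := exists_CW d hd S hne hS
  obtain ⟨t0, o, h0, h1, h2⟩ := h.exists_hex hd
  have hfin' : {c | c + o ∈ S}.Finite :=
    hfin.preimage (f := fun c => c + o) (add_left_injective o).injOn
  have key := (h.translate o).area_hex hd hd1 hfin' h0 h1 h2
  have e : {z : ℝ × ℝ | ∀ c ∈ {c | c + o ∈ S}, sqd z c ≤ 1}
      = (fun z => z + o) ⁻¹' {z : ℝ × ℝ | ∀ c ∈ S, sqd z c ≤ 1} := by
    ext z
    constructor
    · intro hz c hc
      have := hz (c - o) (by simpa using hc)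
      simp only [sqd, Prod.fst_sub, Prod.snd_sub, Prod.fst_add, Prod.snd_add] at this ⊢
      linear_combination this
    · intro hz c hc
      have := hz (c + o) hc
      simp only [sqd, Prod.fst_add, Prod.snd_add] at this ⊢
      linear_combination this
  rw [e, measure_preimage_add_right] at key
  exact key

theorem area_gt_outer_parallel_reuleaux (d : ℝ) (hd1 : 0 < d) (hd2 : d < 1)
    (S : Finset E2) (hS : S.Nonempty) (D : Set E2)
    (hD : D = ⋂ c ∈ S, closedBall c 1) (hint : (interior D).Nonempty)
    (hcp : ∀ c ∈ S, ∀ c' ∈ S, dist c c' ≤ d) :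
    ENNReal.ofReal (1 / 2 * (π - Real.sqrt 3) * d ^ 2 - π * d + π) < volume D := by
  let f : E2 → ℝ × ℝ := fun z => (z 0, z 1)
  have hf : MeasurePreserving f volume volume :=
    (volume_preserving_finTwoArrow ℝ).comp (PiLp.volume_preserving_ofLp (Fin 2))
  have hdist : ∀ x y : E2, dist x y ^ 2 = sqd (f x) (f y) := by
    intro x y
    rw [EuclideanSpace.dist_eq, Real.sq_sqrt (by positivity)]
    simp [Fin.sum_univ_two, sqd, f, Real.dist_eq, sq_abs]
  have key := area_prod d hd1 hd2 (f '' (S : Set E2)) (S.finite_toSet.image f)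
    ((Finset.coe_nonempty.2 hS).image f) (by
      rintro _ ⟨p, hp, rfl⟩ _ ⟨q, hq, rfl⟩
      rw [← hdist]
      exact pow_le_pow_left₀ dist_nonneg (hcp p hp q hq) 2)
  have hclosed : MeasurableSet {z : ℝ × ℝ | ∀ c ∈ f '' (S : Set E2), sqd z c ≤ 1} := by
    have : {z : ℝ × ℝ | ∀ c ∈ f '' (S : Set E2), sqd z c ≤ 1}
        = ⋂ c ∈ f '' (S : Set E2), {z | sqd z c ≤ 1} := by
      ext z; simp
    rw [this]
    exact (isClosed_biInter fun c _ =>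
      isClosed_le (sqd_continuous c) continuous_const).measurableSet
  rw [← hf.measure_preimage hclosed.nullMeasurableSet] at key
  have e : f ⁻¹' {z : ℝ × ℝ | ∀ c ∈ f '' (S : Set E2), sqd z c ≤ 1} = D := by
    rw [hD]
    ext z
    simp only [Set.mem_preimage, Set.mem_iInter, mem_closedBall]
    constructor
    · intro hz c hc
      have := hz (f c) ⟨c, hc, rfl⟩
      rw [← hdist] at this
      exact (sq_le_one_iff₀ dist_nonneg).1 this
    · rintro hz _ ⟨c, hc, rfl⟩
      rw [← hdist]
      exact pow_le_one₀ dist_nonneg (hz c hc)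
  rw [e] at key
  exact key
end
end

section
/- Let D be a disk-polygon with center parameter d, where 1 ≤ d < √3. Then the diameter of the dual disk-polygon satisfies diam(D*) ≤ 1 + (1/2)·√(4 + 2d² − 2√3·d·√(4 − d²)). -/
open Metric Real MeasureTheory
open scoped InnerProductSpace Pointwise ENNReal

noncomputable section

open Filter Topology in
lemma ev_norm_lt (g v : E2) (h : 0 < ⟪v, g⟫_ℝ) : ∀ᶠ t : ℝ in 𝓝[>] 0, ‖g - t • v‖ < ‖g‖ := by
  have hv : 0 < ‖v‖ ^ 2 := by
    have : v ≠ 0 := by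
      rintro rfl
      simp at h
    positivity
  have h1 : (0 : ℝ) < ⟪v, g⟫_ℝ / ‖v‖ ^ 2 := by positivity
  filter_upwards [Ioo_mem_nhdsGT h1] with t ht
  have ht2 : t * ‖v‖ ^ 2 < ⟪v, g⟫_ℝ := (lt_div_iff₀ hv).1 ht.2
  have ht1 : 0 < t := ht.1
  apply lt_of_pow_lt_pow_left₀ 2 (norm_nonneg _)
  rw [norm_sub_sq_real, inner_smul_right, norm_smul, real_inner_comm]
  rw [mul_pow, Real.norm_eq_abs, sq_abs]
  nlinarith

open Filter Topology in
lemma kkt (S : Finset E2) (r : E2) (hr : ∀ c ∈ S, ‖r - c‖ < 1) (hS : S.Nonempty) (x : E2) :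
    ∃ p : E2, (∀ c ∈ S, ‖p - c‖ ≤ 1) ∧ ∃ l : E2 → ℝ, (∀ c ∈ S, 0 ≤ l c) ∧
      (∀ c ∈ S, l c ≠ 0 → ‖c - p‖ = 1) ∧ p - x = ∑ c ∈ S, l c • (c - p) := by
  classical
  set K : Set E2 := {p | ∀ c ∈ S, ‖p - c‖ ≤ 1} with hK
  have hKc : IsCompact K := by
    obtain ⟨c0, hc0⟩ := hS
    apply (isCompact_closedBall c0 1).of_isClosed_subset
    · have : K = ⋂ c ∈ S, {p : E2 | ‖p - c‖ ≤ 1} := by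
        ext p; simp [hK]
      rw [this]
      refine isClosed_biInter fun c _ => ?_
      exact isClosed_le (by fun_prop) (by fun_prop)
    · intro p hp
      rw [mem_closedBall, dist_eq_norm]
      exact hp c0 hc0
  obtain ⟨p, hpK, hpmin⟩ := hKc.exists_isMinOn ⟨r, fun c hc => (hr c hc).le⟩
    (f := fun p => ‖x - p‖) (by fun_prop)
  refine ⟨p, hpK, ?_⟩
  set T := S.filter (fun c => ‖c - p‖ = 1) with hT
  have hmem : p ∈ convexHull ℝ (insert x (T : Set E2)) := by
    by_contra hcon
    obtain ⟨f, a, hfa, hb⟩ := geometric_hahn_banach_point_closed (convex_convexHull ℝ _)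
      ((T.finite_toSet.insert x).isClosed_convexHull ℝ) hcon
    set v := (InnerProductSpace.toDual ℝ E2).symm f
    have hv : ∀ b ∈ insert x (T : Set E2), 0 < ⟪v, b - p⟫_ℝ := by
      intro b hbm
      have := hb b (subset_convexHull ℝ _ hbm)
      rw [InnerProductSpace.toDual_symm_apply, map_sub]
      linarith
    have h1 := ev_norm_lt _ _ (hv x (by simp))
    have h2 : ∀ᶠ t : ℝ in 𝓝[>] 0, ∀ c ∈ S, ‖(c - p) - t • v‖ ≤ 1 := by
      rw [Filter.eventually_all_finset]
      intro c hc
      by_cases hcT : ‖c - p‖ = 1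
      · filter_upwards [ev_norm_lt _ _ (hv c (by simp [hT, hc, hcT]))] with t ht
        linarith
      · have hlt : ‖c - p‖ < 1 := lt_of_le_of_ne (by rw [norm_sub_rev]; exact hpK c hc) hcT
        have hcont : Tendsto (fun t : ℝ => ‖(c - p) - t • v‖) (𝓝[>] 0) (𝓝 ‖(c - p) - (0 : ℝ) • v‖) := by
          apply Tendsto.mono_left _ nhdsWithin_le_nhds
          exact Continuous.tendsto (by fun_prop) 0
        simp only [zero_smul, sub_zero] at hcont
        filter_upwards [hcont.eventually_lt_const hlt] with t ht
        exact ht.le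
    obtain ⟨t, ht1, ht2⟩ := (h1.and h2).exists
    have h3 : p + t • v ∈ K := by
      intro c hc
      rw [show p + t • v - c = -((c - p) - t • v) by abel, norm_neg]
      exact ht2 c hc
    have h4 : ‖x - p‖ ≤ ‖x - (p + t • v)‖ := hpmin h3
    rw [show x - (p + t • v) = x - p - t • v by abel] at h4
    linarith
  by_cases hTe : T.Nonempty
  · rw [convexHull_insert (by exact_mod_cast hTe)] at hmem
    rw [convexJoin_singleton_left] at hmem
    simp only [Set.mem_iUnion] at hmem
    obtain ⟨z, hz, a, b, ha, hb, hab, hp⟩ := hmem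
    rw [Finset.mem_convexHull'] at hz
    obtain ⟨w, hw0, hw1, hwz⟩ := hz
    have hsum : ∑ c ∈ T, w c • (c - p) = z - p := by
      simp only [smul_sub, Finset.sum_sub_distrib]
      rw [hwz, ← Finset.sum_smul, hw1, one_smul]
    have hane : a ≠ 0 := by
      rintro rfl
      have hb1 : b = 1 := by linarith
      subst hb1
      have hzp : z = p := by simpa using hp
      rw [hzp, sub_self] at hsum
      have h0 : ∑ c ∈ T, w c * ⟪r - p, c - p⟫_ℝ = 0 := by
        have := congrArg (fun y => ⟪r - p, y⟫_ℝ) hsum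
        simpa [inner_sum, inner_smul_right] using this
      have hpos : ∀ c ∈ T, 0 < ⟪r - p, c - p⟫_ℝ := by
        intro c hc
        rw [hT, Finset.mem_filter] at hc
        have h5 := hr c hc.1
        have h6 : ‖r - c‖ ^ 2 = ‖r - p‖ ^ 2 - 2 * ⟪r - p, c - p⟫_ℝ + ‖c - p‖ ^ 2 := by
          rw [← norm_sub_sq_real]
          congr 2
          abel
        rw [hc.2] at h6
        nlinarith [norm_nonneg (r - c), sq_nonneg ‖r - p‖]
      have hz : ∀ c ∈ T, w c = 0 := by
        intro c hc
        have := (Finset.sum_eq_zero_iff_of_nonneg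
          (fun c hc => mul_nonneg (hw0 c hc) (hpos c hc).le)).1 h0 c hc
        rcases mul_eq_zero.1 this with h | h
        · exact h
        · exact absurd h (hpos c hc).ne'
      rw [Finset.sum_eq_zero hz] at hw1
      norm_num at hw1
    have hapos : 0 < a := lt_of_le_of_ne ha (Ne.symm hane)
    refine ⟨fun c => if ‖c - p‖ = 1 then b / a * w c else 0, ?_, ?_, ?_⟩
    · intro c hc
      dsimp only
      split_ifs with h
      · exact mul_nonneg (by positivity) (hw0 c (by simp [hT, hc, h]))
      · exact le_rfl
    · intro c hc hne
      by_contra h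
      simp [h] at hne
    · simp only [ite_smul, zero_smul]
      rw [← Finset.sum_filter]
      simp only [mul_smul]
      rw [← Finset.smul_sum, ← hT, hsum]
      have hbz : b • (z - p) = a • (p - x) := by
        have hpp : p = a • p + b • p := by rw [← add_smul, hab, one_smul]
        rw [smul_sub, smul_sub]
        rw [sub_eq_sub_iff_add_eq_add, ← hpp]
        rw [← hp]
        abel
      rw [div_eq_inv_mul, mul_smul, hbz, smul_smul, inv_mul_cancel₀ hane, one_smul]
  · rw [Finset.not_nonempty_iff_eq_empty] at hTe
    simp [hTe] at hmem
    exact ⟨0, by simp, by simp, by simp [hmem]⟩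

/-- Points in the cone of active normals lie in the dual. -/
lemma cone_mem (S : Finset E2) (p : E2) (l : E2 → ℝ) (hl : ∀ c ∈ S, 0 ≤ l c)
    (ha : ∀ c ∈ S, l c ≠ 0 → ‖c - p‖ = 1) (k : ℝ) (hk : 0 < k) (w : E2) (hw : ‖w‖ = 1)
    (hW : k • w = ∑ c ∈ S, l c • (c - p)) (r : E2) (hr : ∀ c ∈ S, ‖r - c‖ ≤ 1) :
    ‖r - (p + w)‖ ≤ 1 := by
  have h1 : k ≤ ∑ c ∈ S, l c := by
    have : ‖k • w‖ = k := by rw [norm_smul, hw, mul_one, Real.norm_of_nonneg hk.le]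
    rw [← this, hW]
    refine (norm_sum_le _ _).trans (Finset.sum_le_sum fun c hc => ?_)
    by_cases h : l c = 0
    · simp [h]
    · rw [norm_smul, ha c hc h, mul_one, Real.norm_of_nonneg (hl c hc)]
  have h2 : (∑ c ∈ S, l c) * ‖r - p‖ ^ 2 ≤ 2 * (k * ⟪r - p, w⟫_ℝ) := by
    rw [← inner_smul_right, hW, inner_sum, Finset.sum_mul, Finset.mul_sum]
    refine Finset.sum_le_sum fun c hc => ?_
    by_cases h : l c = 0
    · simp [h]
    · have h6 : ‖r - c‖ ^ 2 = ‖r - p‖ ^ 2 - 2 * ⟪r - p, c - p⟫_ℝ + ‖c - p‖ ^ 2 := by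
        rw [← norm_sub_sq_real]
        congr 2
        abel
      rw [ha c hc h] at h6
      have h7 : ‖r - c‖ ^ 2 ≤ 1 := by
        have := hr c hc
        nlinarith [norm_nonneg (r - c)]
      rw [inner_smul_right]
      nlinarith [hl c hc]
  have h3 : ‖r - p‖ ^ 2 ≤ 2 * ⟪r - p, w⟫_ℝ := by
    have : k * ‖r - p‖ ^ 2 ≤ k * (2 * ⟪r - p, w⟫_ℝ) := by
      nlinarith [sq_nonneg ‖r - p‖]
    exact le_of_mul_le_mul_left this hk
  have h4 : ‖r - (p + w)‖ ^ 2 ≤ 1 := by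
    rw [show r - (p + w) = (r - p) - w by abel, norm_sub_sq_real, hw]
    linarith
  nlinarith [norm_nonneg (r - (p + w))]

/-- A single active normal making a small angle bounds the distance. -/
lemma bound_of_active (d h s : ℝ) (hd1 : 1 ≤ d) (hh : 0 ≤ h) (hh2 : h ^ 2 = 1 - d ^ 2 / 4)
    (hs : 0 ≤ s) (A p c : E2) (hsA : ‖p - A‖ = s) (hc : ‖c - p‖ = 1) (hA : ‖A - c‖ ≤ d)
    (hin : h * s ≤ ⟪c - p, p - A⟫_ℝ) : s ≤ √3 * d / 2 - h := by
  have h1 : ‖A - c‖ ^ 2 = 1 + 2 * ⟪c - p, p - A⟫_ℝ + s ^ 2 := by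
    rw [← norm_neg, show -(A - c) = (c - p) + (p - A) by abel, norm_add_sq_real, hc, hsA]
    ring
  have h2 : ‖A - c‖ ^ 2 ≤ d ^ 2 := by
    have := norm_nonneg (A - c)
    gcongr
  have h3 : (s + h) ^ 2 ≤ (√3 * d / 2) ^ 2 := by
    rw [div_pow, mul_pow, Real.sq_sqrt (by norm_num)]
    nlinarith
  have h4 : s + h ≤ √3 * d / 2 := by
    apply le_of_sq_le_sq h3 |> fun h => h
    positivity
  linarith

lemma triple (d h : ℝ) (hd1 : 1 ≤ d) (hh : 0 < h) (hh2 : h ^ 2 = 1 - d ^ 2 / 4)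
    (A B C : E2) (hAB : ‖A - B‖ ≤ d) (hAC : ‖A - C‖ ≤ d) (hBC : ‖B - C‖ ≤ d) :
    ∃ q : E2, ‖q - A‖ ≤ √3 * d / 2 - h ∧ ‖q - B‖ ≤ 1 ∧ ‖q - C‖ ≤ 1 := by
  classical
  have hd2 : d < 2 := by nlinarith
  have hρ : h ≤ √3 * d / 2 := by
    have h3 : h ^ 2 ≤ (√3 * d / 2) ^ 2 := by
      rw [div_pow, mul_pow, Real.sq_sqrt (by norm_num)]
      nlinarith
    exact (sq_le_sq₀ hh.le (by positivity)).1 h3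
  have hmid : ∀ c ∈ ({B, C} : Finset E2), ‖(1 / 2 : ℝ) • (B + C) - c‖ < 1 := by
    have e1 : (1 / 2 : ℝ) • (B + C) - B = (-(1 / 2) : ℝ) • (B - C) := by module
    have e2 : (1 / 2 : ℝ) • (B + C) - C = (1 / 2 : ℝ) • (B - C) := by module
    intro c hc
    simp only [Finset.mem_insert, Finset.mem_singleton] at hc
    rcases hc with rfl | rfl
    · rw [e1, norm_smul]; norm_num; linarith
    · rw [e2, norm_smul]; norm_num; linarith
  obtain ⟨p, hpS, l, hl, ha, hp⟩ := kkt {B, C} _ hmid (by simp) A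
  refine ⟨p, ?_, hpS B (by simp), hpS C (by simp)⟩
  have hlm : ∃ m n : ℝ, 0 ≤ m ∧ 0 ≤ n ∧ (m ≠ 0 → ‖B - p‖ = 1) ∧ (n ≠ 0 → ‖C - p‖ = 1) ∧
      p - A = m • (B - p) + n • (C - p) := by
    by_cases hBCe : B = C
    · subst hBCe
      refine ⟨l B, 0, hl B (by simp), le_rfl, ha B (by simp), by simp, ?_⟩
      rw [hp]; simp
    · refine ⟨l B, l C, hl B (by simp), hl C (by simp), ha B (by simp), ha C (by simp), ?_⟩
      rw [hp, Finset.sum_pair hBCe]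
  obtain ⟨m, n, hm, hn, hmB, hnC, hP⟩ := hlm
  set s := ‖p - A‖ with hs
  have hs0 : 0 ≤ s := norm_nonneg _
  by_cases hsz : s = 0
  · rw [hsz]; linarith
  have hspos : 0 < s := lt_of_le_of_ne hs0 (Ne.symm hsz)
  by_cases hB : m ≠ 0 ∧ h * s ≤ ⟪B - p, p - A⟫_ℝ
  · exact bound_of_active d h s hd1 hh.le hh2 hs0 A p B hs.symm (hmB hB.1) hAB hB.2
  by_cases hC : n ≠ 0 ∧ h * s ≤ ⟪C - p, p - A⟫_ℝ
  · exact bound_of_active d h s hd1 hh.le hh2 hs0 A p C hs.symm (hnC hC.1) hAC hC.2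
  exfalso
  have hmB' : m ^ 2 * ‖B - p‖ ^ 2 = m ^ 2 := by
    by_cases h0 : m = 0
    · simp [h0]
    · simp [hmB h0]
  have hnC' : n ^ 2 * ‖C - p‖ ^ 2 = n ^ 2 := by
    by_cases h0 : n = 0
    · simp [h0]
    · simp [hnC h0]
  have hmn : m * n * (2 * h ^ 2 - 1) ≤ m * n * ⟪B - p, C - p⟫_ℝ := by
    by_cases h0 : m = 0
    · simp [h0]
    by_cases h1 : n = 0
    · simp [h1]
    have h6 : ‖B - C‖ ^ 2 = ‖B - p‖ ^ 2 - 2 * ⟪B - p, C - p⟫_ℝ + ‖C - p‖ ^ 2 := by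
      rw [← norm_sub_sq_real]
      congr 2
      abel
    rw [hmB h0, hnC h1] at h6
    have h7 : ‖B - C‖ ^ 2 ≤ d ^ 2 := by
      have := norm_nonneg (B - C)
      gcongr
    apply mul_le_mul_of_nonneg_left _ (mul_nonneg hm hn)
    linarith
  have hs2 : s ^ 2 = m ^ 2 + n ^ 2 + 2 * (m * n * ⟪B - p, C - p⟫_ℝ) := by
    rw [hs, hP, norm_add_sq_real, norm_smul, norm_smul, inner_smul_left, inner_smul_right,
      mul_pow, mul_pow, Real.norm_eq_abs, Real.norm_eq_abs, sq_abs, sq_abs, hmB', hnC']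
    simp only [conj_trivial]
    ring
  have hs3 : s ^ 2 = m * ⟪B - p, p - A⟫_ℝ + n * ⟪C - p, p - A⟫_ℝ := by
    rw [hs, ← real_inner_self_eq_norm_sq]
    nth_rewrite 1 [hP]
    rw [inner_add_left, inner_smul_left, inner_smul_left]
    simp
  have hlow : (h * (m + n)) ^ 2 ≤ s ^ 2 := by
    have : h ^ 2 ≤ 1 := by nlinarith
    nlinarith [mul_nonneg (sub_nonneg.2 this) (sq_nonneg (m - n))]
  have hlow' : h * (m + n) ≤ s := (sq_le_sq₀ (by positivity) hs0).1 hlow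
  have hmle : m * ⟪B - p, p - A⟫_ℝ ≤ m * (h * s) := by
    by_cases h0 : m = 0
    · simp [h0]
    · have : ¬ (h * s ≤ ⟪B - p, p - A⟫_ℝ) := fun h => hB ⟨h0, h⟩
      exact mul_le_mul_of_nonneg_left (not_le.1 this).le hm
  have hnle : n * ⟪C - p, p - A⟫_ℝ ≤ n * (h * s) := by
    by_cases h0 : n = 0
    · simp [h0]
    · have : ¬ (h * s ≤ ⟪C - p, p - A⟫_ℝ) := fun h => hC ⟨h0, h⟩
      exact mul_le_mul_of_nonneg_left (not_le.1 this).le hn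
  have hlt : m * ⟪B - p, p - A⟫_ℝ + n * ⟪C - p, p - A⟫_ℝ < (m + n) * (h * s) := by
    by_cases h0 : m = 0
    · by_cases h1 : n = 0
      · rw [h0, h1] at hs3
        simp at hs3
        exact absurd hs3 hsz
      · have : ¬ (h * s ≤ ⟪C - p, p - A⟫_ℝ) := fun h => hC ⟨h1, h⟩
        have := mul_lt_mul_of_pos_left (not_le.1 this) (lt_of_le_of_ne hn (Ne.symm h1))
        linarith
    · have : ¬ (h * s ≤ ⟪B - p, p - A⟫_ℝ) := fun h => hB ⟨h0, h⟩
      have := mul_lt_mul_of_pos_left (not_le.1 this) (lt_of_le_of_ne hm (Ne.symm h0))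
      linarith
  nlinarith

lemma card_two_sub (S J : Finset E2) (A : E2) (hA : A ∈ S) (hJ : J ⊆ S) (hc : J.card ≤ 2) :
    ∃ B ∈ S, ∃ C ∈ S, ∀ c ∈ J, c = B ∨ c = C := by
  classical
  have h : J.card = 0 ∨ J.card = 1 ∨ J.card = 2 := by omega
  rcases h with h | h | h
  · rw [Finset.card_eq_zero] at h
    subst h
    exact ⟨A, hA, A, hA, by simp⟩
  · obtain ⟨B, rfl⟩ := Finset.card_eq_one.1 h
    exact ⟨B, hJ (by simp), B, hJ (by simp), by simp⟩
  · obtain ⟨B, C, -, rfl⟩ := Finset.card_eq_two.1 h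
    exact ⟨B, hJ (by simp), C, hJ (by simp), by simp⟩

lemma vertex (d h : ℝ) (hd1 : 1 ≤ d) (hh : 0 < h) (hh2 : h ^ 2 = 1 - d ^ 2 / 4)
    (S : Finset E2) (r : E2) (hr : ∀ c ∈ S, ‖r - c‖ < 1)
    (hcp : ∀ c ∈ S, ∀ c' ∈ S, ‖c - c'‖ ≤ d) (A : E2) (hA : A ∈ S) :
    ∃ q : E2, ‖q - A‖ ≤ √3 * d / 2 - h ∧ ∀ c ∈ S, ‖q - c‖ ≤ 1 := by
  classical
  set F : Option E2 → Set E2 := fun o => o.elim (closedBall A (√3 * d / 2 - h))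
    (fun c => closedBall c 1) with hF
  have key : (⋂ i ∈ Finset.insertNone S, F i).Nonempty := by
    apply Convex.helly_theorem' (𝕜 := ℝ)
    · intro i _
      cases i with
      | none => exact convex_closedBall _ _
      | some c => exact convex_closedBall _ _
    · intro I hI hcard
      have hfr : Module.finrank ℝ E2 = 2 := by simp
      rw [hfr] at hcard
      have hsub : Finset.eraseNone I ⊆ S := by
        intro c hc
        rw [Finset.mem_eraseNone] at hc
        simpa using hI hc
      by_cases hn : none ∈ I
      · have hc2 : (Finset.eraseNone I).card ≤ 2 := by
          have : (Finset.eraseNone I).card < I.card := by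
            rw [← Finset.card_map Function.Embedding.some, Finset.map_some_eraseNone]
            exact Finset.card_erase_lt_of_mem hn
          omega
        obtain ⟨B, hB, C, hC, hBC⟩ := card_two_sub S _ A hA hsub hc2
        obtain ⟨q, hq1, hq2, hq3⟩ := triple d h hd1 hh hh2 A B C (hcp A hA B hB)
          (hcp A hA C hC) (hcp B hB C hC)
        refine ⟨q, ?_⟩
        simp only [Set.mem_iInter]
        intro i hi
        cases i with
        | none => simpa [hF, dist_eq_norm] using hq1
        | some c =>
          rcases hBC c (Finset.mem_eraseNone.2 hi) with rfl | rfl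
          · simpa [hF, dist_eq_norm] using hq2
          · simpa [hF, dist_eq_norm] using hq3
      · refine ⟨r, ?_⟩
        simp only [Set.mem_iInter]
        intro i hi
        cases i with
        | none => exact absurd hi hn
        | some c =>
          have := (hr c (hsub (Finset.mem_eraseNone.2 hi))).le
          simpa [hF, dist_eq_norm] using this
  obtain ⟨q, hq⟩ := key
  simp only [Set.mem_iInter] at hq
  refine ⟨q, ?_, fun c hc => ?_⟩
  · simpa [hF, dist_eq_norm] using hq none (by simp)
  · simpa [hF, dist_eq_norm] using hq (some c) (by simpa using hc)

lemma onb_decomp (u v : E2) (hu : ‖u‖ = 1) (hv : ‖v‖ = 1) (huv : ⟪u, v⟫_ℝ = 0) (w : E2) :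
    w = ⟪w, u⟫_ℝ • u + ⟪w, v⟫_ℝ • v := by
  have h1 : u 0 ^ 2 + u 1 ^ 2 = 1 := by
    have := EuclideanSpace.real_norm_sq_eq u
    rw [hu, Fin.sum_univ_two] at this
    linarith
  have h2 : v 0 ^ 2 + v 1 ^ 2 = 1 := by
    have := EuclideanSpace.real_norm_sq_eq v
    rw [hv, Fin.sum_univ_two] at this
    linarith
  have hin : ∀ a b : E2, ⟪a, b⟫_ℝ = a 0 * b 0 + a 1 * b 1 := by
    intro a b
    simp [PiLp.inner_apply, Fin.sum_univ_two]
    ring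
  rw [hin] at huv
  obtain ⟨e, he⟩ : ∃ e, e = u 0 * v 1 - u 1 * v 0 := ⟨_, rfl⟩
  have hv0 : v 0 = - e * u 1 := by
    rw [he]; linear_combination (-(v 0)) * h1 + u 0 * huv
  have hv1 : v 1 = e * u 0 := by
    rw [he]; linear_combination (-(v 1)) * h1 + u 1 * huv
  have he2 : e ^ 2 = 1 := by
    rw [hv0, hv1] at h2
    linear_combination h2 - e ^ 2 * h1
  rw [hin, hin]
  ext i
  fin_cases i
  · simp
    rw [hv0, hv1]
    linear_combination (-(w 0)) * h1 + (-(w 0) * u 1 ^ 2 + w 1 * u 0 * u 1) * he2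
  · simp
    rw [hv0, hv1]
    linear_combination (-(w 1)) * h1 + (-(w 1) * u 0 ^ 2 + w 0 * u 0 * u 1) * he2

lemma exists_orth (u : E2) (hu : ‖u‖ = 1) : ∃ v : E2, ‖v‖ = 1 ∧ ⟪u, v⟫_ℝ = 0 := by
  have h1 : u 0 ^ 2 + u 1 ^ 2 = 1 := by
    have := EuclideanSpace.real_norm_sq_eq u
    rw [hu, Fin.sum_univ_two] at this
    linarith
  refine ⟨!₂[-u 1, u 0], ?_, ?_⟩
  · rw [← sq_eq_sq₀ (norm_nonneg _) zero_le_one, EuclideanSpace.real_norm_sq_eq]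
    simp [Fin.sum_univ_two]
    linarith
  · simp [PiLp.inner_apply, Fin.sum_univ_two]
    ring

/-- Near a farthest point of the dual which is not a center, the boundary is a unit arc. -/
lemma arc (S : Finset E2) (hS : S.Nonempty) (r0 : E2) (hr0 : ∀ c ∈ S, ‖r0 - c‖ < 1)
    (x y u v : E2) (L : ℝ) (hL : 1 < L)
    (hy : ∀ r : E2, (∀ c ∈ S, ‖r - c‖ ≤ 1) → ‖r - y‖ ≤ 1)
    (hmax : ∀ z : E2, (∀ r : E2, (∀ c ∈ S, ‖r - c‖ ≤ 1) → ‖r - z‖ ≤ 1) → ‖z - x‖ ≤ L)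
    (hyS : y ∉ S) (hu : ‖u‖ = 1) (hv : ‖v‖ = 1) (huv : ⟪u, v⟫_ℝ = 0) (hyx : y - x = L • u) :
    ∃ T : ℝ, 0 < T ∧ ∀ t : ℝ, 0 < t → t < T → ∀ r : E2, (∀ c ∈ S, ‖r - c‖ ≤ 1) →
      ‖r - (y - u + (√(1 + t ^ 2))⁻¹ • (u + t • v))‖ ≤ 1 := by
  classical
  obtain ⟨p, hpS, l, hl, ha, hp⟩ := kkt S r0 hr0 hS x
  obtain ⟨s, hs⟩ : ∃ s, s = ‖p - x‖ := ⟨_, rfl⟩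
  have hyxn : ‖y - x‖ = L := by
    rw [hyx, norm_smul, hu, mul_one, Real.norm_of_nonneg (by linarith)]
  have hpy := hy p hpS
  have hsL : L - 1 ≤ s := by
    have : ‖y - x‖ ≤ ‖y - p‖ + ‖p - x‖ := norm_sub_le_norm_sub_add_norm_sub _ _ _
    rw [norm_sub_rev y p] at this
    linarith
  have hspos : 0 < s := by linarith
  have hsL' : s + 1 ≤ L := by
    have hw : ‖s⁻¹ • (p - x)‖ = 1 := by
      rw [norm_smul, ← hs, norm_inv, Real.norm_of_nonneg hspos.le, inv_mul_cancel₀ hspos.ne']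
    have := hmax (p + s⁻¹ • (p - x)) (fun r hr => cone_mem S p l hl ha s hspos _ hw
      (by rw [smul_smul, mul_inv_cancel₀ hspos.ne', one_smul, hp]) r hr)
    rw [show p + s⁻¹ • (p - x) - x = (1 + s⁻¹) • (p - x) by module, norm_smul, ← hs,
      Real.norm_of_nonneg (by positivity), add_mul, inv_mul_cancel₀ hspos.ne'] at this
    linarith
  have hsl : s = L - 1 := by linarith
  have hpx : p - x = s • u := by
    have h1 : ‖p - y‖ ^ 2 = s ^ 2 - 2 * (L * ⟪p - x, u⟫_ℝ) + L ^ 2 := by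
      rw [show p - y = (p - x) - (y - x) by abel, hyx, norm_sub_sq_real, ← hs, inner_smul_right,
        norm_smul, hu, mul_one, Real.norm_of_nonneg (by linarith)]
    have h2 : ‖p - y‖ ^ 2 ≤ 1 := by nlinarith [norm_nonneg (p - y)]
    have h3 : s ≤ ⟪p - x, u⟫_ℝ := by
      have : L * s ≤ L * ⟪p - x, u⟫_ℝ := by
        subst hsl
        nlinarith
      exact le_of_mul_le_mul_left this (by linarith)
    have h4 : ‖(p - x) - s • u‖ ^ 2 ≤ 0 := by
      rw [norm_sub_sq_real, ← hs, inner_smul_right,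
        norm_smul, hu, mul_one, Real.norm_of_nonneg hspos.le]
      nlinarith
    have h5 : ‖(p - x) - s • u‖ = 0 := by
      have := sq_nonneg ‖(p - x) - s • u‖
      exact pow_eq_zero_iff (two_ne_zero) |>.1 (le_antisymm h4 this)
    exact sub_eq_zero.1 (norm_eq_zero.1 h5)
  have hyp : y = p + u := by
    have : y - p = u := by
      rw [show y - p = (y - x) - (p - x) by abel, hyx, hpx, ← sub_smul, hsl]
      simp
    rw [← this]; abel
  have hsu : s • u = ∑ c ∈ S, l c • (c - p) := by rw [← hpx, hp]
  have hex : ∃ b ∈ S, 0 < l b ∧ 0 < ⟪b - p, v⟫_ℝ := by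
    by_contra hcon
    push Not at hcon
    have h0 : ∑ c ∈ S, l c * ⟪c - p, v⟫_ℝ = 0 := by
      have := congrArg (fun z => ⟪z, v⟫_ℝ) hsu
      simp only [sum_inner, inner_smul_left, huv, conj_trivial, mul_zero] at this
      exact this.symm
    have hnp : ∀ c ∈ S, l c * ⟪c - p, v⟫_ℝ ≤ 0 := by
      intro c hc
      rcases (hl c hc).eq_or_lt with h | h
      · simp [← h]
      · exact mul_nonpos_of_nonneg_of_nonpos h.le (hcon c hc h)
    have hz := (Finset.sum_eq_zero_iff_of_nonpos hnp).1 h0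
    have h1 : ∑ c ∈ S, l c * ⟪c - p, u⟫_ℝ = s := by
      have := congrArg (fun z => ⟪z, u⟫_ℝ) hsu
      simp only [sum_inner, inner_smul_left, conj_trivial, real_inner_self_eq_norm_sq, hu] at this
      linarith
    have h2 : ∑ c ∈ S, l c * ⟪c - p, u⟫_ℝ ≤ 0 := by
      refine Finset.sum_nonpos fun c hc => ?_
      by_cases h : l c = 0
      · simp [h]
      have hcv : ⟪c - p, v⟫_ℝ = 0 := (mul_eq_zero.1 (hz c hc)).resolve_left h
      have hdec := onb_decomp u v hu hv huv (c - p)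
      rw [hcv, zero_smul, add_zero] at hdec
      have hn := ha c hc h
      have habs : |⟪c - p, u⟫_ℝ| = 1 := by
        rw [hdec, norm_smul, hu, mul_one] at hn
        exact hn
      rcases eq_or_eq_neg_of_abs_eq habs with h3 | h3
      · exfalso
        rw [h3, one_smul] at hdec
        apply hyS
        rw [hyp, ← hdec]
        simpa using hc
      · rw [h3]
        have := hl c hc
        linarith
    linarith
  obtain ⟨b, hbS, hlb, hD⟩ := hex
  have hbdec := onb_decomp u v hu hv huv (b - p)
  have hbn := ha b hbS hlb.ne'
  have ha1 : ⟪b - p, u⟫_ℝ ≤ 1 := by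
    have := real_inner_le_norm (b - p) u
    rw [hbn, hu] at this
    linarith
  set a := ⟪b - p, u⟫_ℝ
  set D := ⟪b - p, v⟫_ℝ
  refine ⟨D, hD, fun t ht htD r hr => ?_⟩
  have hden : 0 < D - t * a := by nlinarith
  have hyu : y - u = p := by rw [hyp]; abel
  rw [hyu]
  have hq : 0 < √(1 + t ^ 2) := by positivity
  have hq2 : √(1 + t ^ 2) ^ 2 = 1 + t ^ 2 := Real.sq_sqrt (by positivity)
  have hnorm : ‖u + t • v‖ = √(1 + t ^ 2) := by
    rw [← sq_eq_sq₀ (norm_nonneg _) hq.le, hq2, norm_add_sq_real, inner_smul_right, huv,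
      norm_smul, hu, hv, Real.norm_of_nonneg ht.le]
    ring
  refine cone_mem S p (fun c => l c + if c = b then s * (t / (D - t * a)) else 0) ?_ ?_
    (s * (D / (D - t * a)) * √(1 + t ^ 2)) (by positivity) _ ?_ ?_ r hr
  · intro c hc
    have := hl c hc
    split_ifs
    · positivity
    · simpa using this
  · intro c hc h
    by_cases hcb : c = b
    · rw [hcb]; exact hbn
    · simp only [hcb, if_false, add_zero] at h
      exact ha c hc h
  · rw [norm_smul, hnorm, norm_inv, Real.norm_of_nonneg hq.le, inv_mul_cancel₀ hq.ne']
  · simp only [add_smul, Finset.sum_add_distrib, ite_smul, zero_smul]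
    rw [← hsu, Finset.sum_ite_eq' S b, if_pos hbS, hbdec, smul_smul, mul_assoc,
      mul_inv_cancel₀ hq.ne', mul_one]
    have e1 : s * (D / (D - t * a)) = s + s * (t / (D - t * a)) * a := by
      field_simp
      ring
    have e2 : s * (D / (D - t * a)) * t = s * (t / (D - t * a)) * D := by
      field_simp
    rw [smul_add, smul_add, smul_smul, smul_smul, smul_smul, ← add_assoc, ← add_smul, e2, e1]

lemma main_bound (d h : ℝ) (hd1 : 1 ≤ d) (hh : 0 < h) (hh2 : h ^ 2 = 1 - d ^ 2 / 4)
    (S : Finset E2) (hS : S.Nonempty) (r0 r1 : E2) (hr01 : r0 ≠ r1)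
    (hr0 : ∀ c ∈ S, ‖r0 - c‖ < 1) (hr1 : ∀ c ∈ S, ‖r1 - c‖ ≤ 1)
    (hcp : ∀ c ∈ S, ∀ c' ∈ S, ‖c - c'‖ ≤ d) (x y : E2)
    (hx : ∀ r : E2, (∀ c ∈ S, ‖r - c‖ ≤ 1) → ‖r - x‖ ≤ 1)
    (hy : ∀ r : E2, (∀ c ∈ S, ‖r - c‖ ≤ 1) → ‖r - y‖ ≤ 1)
    (hmax : ∀ z w : E2, (∀ r : E2, (∀ c ∈ S, ‖r - c‖ ≤ 1) → ‖r - z‖ ≤ 1) →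
      (∀ r : E2, (∀ c ∈ S, ‖r - c‖ ≤ 1) → ‖r - w‖ ≤ 1) → ‖z - w‖ ≤ ‖y - x‖) :
    ‖y - x‖ ≤ 1 + (√3 * d / 2 - h) := by
  have hρ : h ≤ √3 * d / 2 := by
    have h3 : h ^ 2 ≤ (√3 * d / 2) ^ 2 := by
      rw [div_pow, mul_pow, Real.sq_sqrt (by norm_num)]
      nlinarith
    exact (sq_le_sq₀ hh.le (by positivity)).1 h3
  have hvert : ∀ A ∈ S, ∀ z : E2, (∀ r : E2, (∀ c ∈ S, ‖r - c‖ ≤ 1) → ‖r - z‖ ≤ 1) →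
      ‖A - z‖ ≤ 1 + (√3 * d / 2 - h) := by
    intro A hA z hz
    obtain ⟨q, hq1, hq2⟩ := vertex d h hd1 hh hh2 S r0 hr0 hcp A hA
    have h1 : ‖A - z‖ ≤ ‖A - q‖ + ‖q - z‖ := norm_sub_le_norm_sub_add_norm_sub _ _ _
    have h2 := hz q hq2
    rw [norm_sub_rev A q] at h1
    linarith
  by_contra hcon
  push Not at hcon
  obtain ⟨L, hLdef⟩ : ∃ L, L = ‖y - x‖ := ⟨_, rfl⟩
  rw [← hLdef] at hcon hmax
  have hL1 : 1 < L := by linarith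
  have hyS : y ∉ S := fun hmem => by
    have := hvert y hmem x hx
    linarith
  have hxS : x ∉ S := fun hmem => by
    have := hvert x hmem y hy
    rw [norm_sub_rev] at this
    linarith
  have hL2 : L < 2 := by
    by_contra hge
    push Not at hge
    have hmid : ∀ r : E2, (∀ c ∈ S, ‖r - c‖ ≤ 1) → (r - x) + (r - y) = 0 := by
      intro r hr
      have h1 := hx r hr
      have h2 := hy r hr
      have h3 := parallelogram_law_with_norm ℝ (r - x) (r - y)
      rw [show r - x - (r - y) = y - x by abel, ← hLdef] at h3
      have h4 : ‖r - x + (r - y)‖ * ‖r - x + (r - y)‖ ≤ 0 := by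
        nlinarith [norm_nonneg (r - x), norm_nonneg (r - y)]
      have h5 : ‖r - x + (r - y)‖ = 0 := mul_self_eq_zero.1 (le_antisymm h4 (mul_self_nonneg _))
      exact norm_eq_zero.1 h5
    have e0 := hmid r0 (fun c hc => (hr0 c hc).le)
    have e1 := hmid r1 hr1
    apply hr01
    have : (2 : ℝ) • (r0 - r1) = 0 := by
      rw [show (2 : ℝ) • (r0 - r1) = ((r0 - x) + (r0 - y)) - ((r1 - x) + (r1 - y)) by module,
        e0, e1, sub_zero]
    rw [smul_eq_zero] at this
    exact sub_eq_zero.1 (this.resolve_left two_ne_zero)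
  have hL0 : 0 < L := by linarith
  obtain ⟨u, hudef⟩ : ∃ u : E2, u = L⁻¹ • (y - x) := ⟨_, rfl⟩
  have hu : ‖u‖ = 1 := by
    rw [hudef, norm_smul, ← hLdef, norm_inv, Real.norm_of_nonneg hL0.le, inv_mul_cancel₀ hL0.ne']
  have hyx : y - x = L • u := by
    rw [hudef, smul_smul, mul_inv_cancel₀ hL0.ne', one_smul]
  have hxy : x - y = L • (-u) := by
    rw [smul_neg, ← hyx]; abel
  obtain ⟨v, hv, huv⟩ := exists_orth u hu
  obtain ⟨T1, hT1, h1⟩ := arc S hS r0 hr0 x y u v L hL1 hy (fun z hz => hmax z x hz hx) hyS hu hv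
    huv hyx
  obtain ⟨T2, hT2, h2⟩ := arc S hS r0 hr0 y x (-u) (-v) L hL1 hx (fun z hz => hmax z y hz hy) hxS
    (by simpa using hu) (by simpa using hv) (by simpa using huv) hxy
  obtain ⟨t, ht0, ht⟩ := exists_between (lt_min hT1 hT2)
  have h3 := hmax _ _ (h1 t ht0 (lt_of_lt_of_le ht (min_le_left _ _)))
    (h2 t ht0 (lt_of_lt_of_le ht (min_le_right _ _)))
  obtain ⟨k, hk⟩ : ∃ k, k = (√(1 + t ^ 2))⁻¹ := ⟨_, rfl⟩
  rw [← hk] at h3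
  have hq1 : 1 < √(1 + t ^ 2) := by
    apply Real.lt_sqrt_of_sq_lt
    nlinarith
  have hk1 : k < 1 := by
    rw [hk]; exact inv_lt_one_of_one_lt₀ hq1
  have hk2 : k ^ 2 * (1 + t ^ 2) = 1 := by
    rw [hk, inv_pow, Real.sq_sqrt (by positivity)]
    field_simp
  have e : y - u + k • (u + t • v) - (x - -u + k • (-u + t • -v))
      = (L - 2 + 2 * k) • u + (2 * k * t) • v := by
    rw [show y - u + k • (u + t • v) - (x - -u + k • (-u + t • -v))
      = (y - x) + ((2 * k - 2) • u + (2 * k * t) • v) by module, hyx]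
    module
  rw [e] at h3
  have h4 : ‖(L - 2 + 2 * k) • u + (2 * k * t) • v‖ ^ 2 = (L - 2 + 2 * k) ^ 2 + (2 * k * t) ^ 2 := by
    rw [norm_add_sq_real, inner_smul_left, inner_smul_right, huv, norm_smul, norm_smul, hu, hv,
      mul_one, mul_one, Real.norm_eq_abs, Real.norm_eq_abs, sq_abs, sq_abs]
    simp
  have h5 : ‖(L - 2 + 2 * k) • u + (2 * k * t) • v‖ ^ 2 ≤ L ^ 2 := by
    gcongr
  rw [h4] at h5
  nlinarith [mul_pos (sub_pos.2 hL2) (sub_pos.2 hk1)]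

/-- For a disk-polygon with center parameter `d`, `1 ≤ d < √3`, the diameter of
the dual disk-polygon is at most `diam(Δ(d)*)`. -/
theorem diam_dual_le (d : ℝ) (hd1 : 1 ≤ d) (hd2 : d < Real.sqrt 3)
    (S : Finset E2) (hS : S.Nonempty) (D : Set E2)
    (hD : D = ⋂ c ∈ S, closedBall c 1) (hint : (interior D).Nonempty)
    (hcp : ∀ c ∈ S, ∀ c' ∈ S, dist c c' ≤ d) :
    Metric.diam (dualDP D)
      ≤ 1 + 1 / 2 * Real.sqrt (4 + 2 * d ^ 2 - 2 * Real.sqrt 3 * d * Real.sqrt (4 - d ^ 2)) := by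
  obtain ⟨h, hhdef⟩ : ∃ h, h = √(4 - d ^ 2) / 2 := ⟨_, rfl⟩
  have hd3 : d ^ 2 < 3 := by
    have := Real.sq_sqrt (show (0 : ℝ) ≤ 3 by norm_num)
    have := Real.sqrt_nonneg 3
    nlinarith
  have hsq : √(4 - d ^ 2) ^ 2 = 4 - d ^ 2 := Real.sq_sqrt (by linarith)
  have hh : 0 < h := by
    have : 0 < √(4 - d ^ 2) := Real.sqrt_pos.2 (by linarith)
    rw [hhdef]; positivity
  have hh2 : h ^ 2 = 1 - d ^ 2 / 4 := by
    rw [hhdef, div_pow, hsq]; ring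
  have h3 : √3 ^ 2 = 3 := Real.sq_sqrt (by norm_num)
  have hRHS : 1 + (√3 * d / 2 - h)
      ≤ 1 + 1 / 2 * √(4 + 2 * d ^ 2 - 2 * √3 * d * √(4 - d ^ 2)) := by
    have : √3 * d - √(4 - d ^ 2) ≤ √(4 + 2 * d ^ 2 - 2 * √3 * d * √(4 - d ^ 2)) := by
      apply Real.le_sqrt_of_sq_le
      nlinarith
    rw [hhdef]
    linarith
  refine le_trans ?_ hRHS
  have hDm : ∀ r : E2, r ∈ D ↔ ∀ c ∈ S, ‖r - c‖ ≤ 1 := by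
    intro r
    rw [hD]
    simp [dist_eq_norm]
  have hQ : ∀ z : E2, z ∈ dualDP D ↔ ∀ r : E2, (∀ c ∈ S, ‖r - c‖ ≤ 1) → ‖r - z‖ ≤ 1 := by
    intro z
    constructor
    · intro hz r hr
      rw [← dist_eq_norm]
      exact hz r ((hDm r).2 hr)
    · intro hz r hr
      rw [dist_eq_norm]
      exact hz r ((hDm r).1 hr)
  obtain ⟨r0, hr0⟩ := hint
  have hr0S : ∀ c ∈ S, ‖r0 - c‖ < 1 := by
    intro c hc
    have hsub : D ⊆ closedBall c 1 := by
      intro r hr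
      rw [mem_closedBall, dist_eq_norm]
      exact (hDm r).1 hr c hc
    have := interior_mono hsub hr0
    rw [interior_closedBall _ one_ne_zero, mem_ball, dist_eq_norm] at this
    exact this
  obtain ⟨r1, hr1D, hr01⟩ : ∃ r1 ∈ D, r0 ≠ r1 := by
    by_contra hcon
    push Not at hcon
    have hsub : D ⊆ {r0} := fun r hr => (hcon r hr).symm
    have := interior_mono hsub hr0
    rw [interior_singleton] at this
    exact this
  have hcompact : IsCompact (dualDP D) := by
    apply (isCompact_closedBall r0 1).of_isClosed_subset
    · have : dualDP D = ⋂ r ∈ D, {y : E2 | dist r y ≤ 1} := by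
        ext y; simp [dualDP]
      rw [this]
      refine isClosed_biInter fun c _ => ?_
      exact isClosed_le (by fun_prop) (by fun_prop)
    · intro y hy
      rw [mem_closedBall, dist_comm]
      exact hy r0 (interior_subset hr0)
  have hne : (dualDP D).Nonempty := by
    obtain ⟨c, hc⟩ := hS
    exact ⟨c, (hQ c).2 fun r hr => hr c hc⟩
  obtain ⟨⟨y, x⟩, hyx, hmax⟩ := (hcompact.prod hcompact).exists_isMaxOn (hne.prod hne)
    (f := fun q : E2 × E2 => ‖q.1 - q.2‖) (by fun_prop)
  have hmax' : ∀ z ∈ dualDP D, ∀ w ∈ dualDP D, ‖z - w‖ ≤ ‖y - x‖ := fun z hz w hw =>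
    isMaxOn_iff.1 hmax (z, w) (Set.mk_mem_prod hz hw)
  have hb := main_bound d h hd1 hh hh2 S hS r0 r1 hr01 hr0S ((hDm r1).1 hr1D)
    (fun c hc c' hc' => by rw [← dist_eq_norm]; exact hcp c hc c' hc') x y
    ((hQ x).1 hyx.2) ((hQ y).1 hyx.1)
    (fun z w hz hw => hmax' z ((hQ z).2 hz) w ((hQ w).2 hw))
  apply Metric.diam_le_of_forall_dist_le (le_trans (norm_nonneg _) hb)
  intro z hz w hw
  rw [dist_eq_norm]
  exact (hmax' z hz w hw).trans hb
end
end

section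
/- Let 0 < d < 1 and let R_d be the Reuleaux triangle of width d given as the intersection of the three closed balls of radius d in ℝ² centered at v₁ = (0,0), v₂ = (d,0), v₃ = (d/2, (√3/2)·d). Then the area of the outer parallel domain of radius 1−d of R_d, i.e. of the Minkowski sum R_d + closedBall(0, 1−d), equals (1/2)·(π − √3)·d² − π·d + π. -/
open Metric Real MeasureTheory
open scoped InnerProductSpace Pointwise ENNReal

noncomputable section

theorem norm_comb_sq (d : ℝ) (u w : E2) (hu : ‖u‖ = d) (hw : ‖w‖ = d)
    (huw : ⟪u, w⟫_ℝ = d ^ 2 / 2) (a b : ℝ) :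
    ‖a • u + b • w‖ ^ 2 = d ^ 2 * (a ^ 2 + b ^ 2 + a * b) := by
  rw [norm_add_sq_real, norm_smul, norm_smul, inner_smul_left, inner_smul_right, huw, hu, hw,
    mul_pow, mul_pow, Real.norm_eq_abs, Real.norm_eq_abs, sq_abs, sq_abs]
  simp only [conj_trivial]
  ring

theorem sector_mem (d : ℝ) (hd : 0 < d) (v u w : E2) (hu : ‖u‖ = d) (hw : ‖w‖ = d)
    (huw : ⟪u, w⟫_ℝ = d ^ 2 / 2) (a b : ℝ) (ha : 0 ≤ a) (hb : 0 ≤ b)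
    (h : ‖a • u + b • w‖ ≤ d) :
    v + (a • u + b • w) ∈ closedBall v d ∩ closedBall (v + u) d ∩ closedBall (v + w) d := by
  have h1 : ‖a • u + b • w‖ ^ 2 ≤ d ^ 2 := by gcongr
  rw [norm_comb_sq d u w hu hw huw] at h1
  have h2 : a ^ 2 + b ^ 2 + a * b ≤ 1 := by
    have : 0 < d ^ 2 := by positivity
    by_contra hc
    push Not at hc
    nlinarith
  have h3 : a ^ 2 + b ^ 2 + a * b ≤ a + b := by
    rcases le_total 1 (a + b) with h | h
    · linarith
    · nlinarith [mul_nonneg ha hb]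
  refine ⟨⟨?_, ?_⟩, ?_⟩
  · simpa [dist_eq_norm] using h
  · rw [mem_closedBall, dist_eq_norm,
      show v + (a • u + b • w) - (v + u) = (a - 1) • u + b • w by module]
    refine le_of_sq_le_sq ?_ hd.le
    rw [norm_comb_sq d u w hu hw huw]
    have : (a - 1) ^ 2 + b ^ 2 + (a - 1) * b ≤ 1 := by nlinarith
    nlinarith [sq_nonneg d]
  · rw [mem_closedBall, dist_eq_norm,
      show v + (a • u + b • w) - (v + w) = a • u + (b - 1) • w by module]
    refine le_of_sq_le_sq ?_ hd.le
    rw [norm_comb_sq d u w hu hw huw]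
    have : a ^ 2 + (b - 1) ^ 2 + a * (b - 1) ≤ 1 := by nlinarith
    nlinarith [sq_nonneg d]

theorem pos_mem_iff (d : ℝ) (hd : 0 < d) (hd2 : d < 1) (v u w : E2) (hu : ‖u‖ = d) (hw : ‖w‖ = d)
    (huw : ⟪u, w⟫_ℝ = d ^ 2 / 2) (a b : ℝ) (ha : 0 ≤ a) (hb : 0 ≤ b) :
    v + (a • u + b • w) ∈ (closedBall v d ∩ closedBall (v + u) d ∩ closedBall (v + w) d)
      + closedBall (0 : E2) (1 - d) ↔ v + (a • u + b • w) ∈ closedBall v 1 := by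
  constructor
  · rintro ⟨r, ⟨⟨hr, -⟩, -⟩, c, hc, hrc⟩
    simp only at hrc
    rw [← hrc, mem_closedBall, dist_eq_norm]
    rw [mem_closedBall, dist_eq_norm] at hr
    rw [mem_closedBall, dist_zero_right] at hc
    calc ‖r + c - v‖ = ‖(r - v) + c‖ := by congr 1; abel
      _ ≤ _ := norm_add_le _ _
      _ ≤ 1 := by linarith
  · intro h
    have h : ‖a • u + b • w‖ ≤ 1 := by simpa [dist_eq_norm] using h
    rcases le_total ‖a • u + b • w‖ d with h' | h'
    · refine ⟨_, sector_mem d hd v u w hu hw huw a b ha hb h', 0, ?_, by simp⟩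
      simp [hd2.le]
    · set n := ‖a • u + b • w‖ with hn
      have hn0 : 0 < n := hd.trans_le h'
      have key : (d / n * a) • u + (d / n * b) • w = (d / n) • (a • u + b • w) := by module
      refine ⟨_, sector_mem d hd v u w hu hw huw (d / n * a) (d / n * b) (by positivity)
        (by positivity) ?_, (1 - d / n) • (a • u + b • w), ?_, ?_⟩
      · rw [key, norm_smul, ← hn, Real.norm_eq_abs, abs_of_pos (by positivity)]
        field_simp; rfl
      · have : d / n ≤ 1 := (div_le_one hn0).2 h'
        rw [mem_closedBall, dist_zero_right, norm_smul, ← hn, Real.norm_eq_abs,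
          abs_of_nonneg (by linarith)]
        have : (1 - d / n) * n = n - d := by field_simp
        linarith
      · simp only
        module

theorem opp_mem_iff (d : ℝ) (hd : 0 < d) (hd2 : d < 1) (v u w : E2) (hu : ‖u‖ = d) (hw : ‖w‖ = d)
    (huw : ⟪u, w⟫_ℝ = d ^ 2 / 2) (a b : ℝ) (ha : a ≤ 0) (hb : b ≤ 0) :
    v + (a • u + b • w) ∈ (closedBall v d ∩ closedBall (v + u) d ∩ closedBall (v + w) d)
      + closedBall (0 : E2) (1 - d) ↔ v + (a • u + b • w) ∈ closedBall v (1 - d) := by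
  constructor
  · rintro ⟨r, ⟨⟨-, hr1⟩, hr2⟩, c, hc, hrc⟩
    simp only at hrc
    rw [mem_closedBall, dist_zero_right] at hc
    rw [mem_closedBall, dist_eq_norm] at hr1 hr2 ⊢
    obtain ⟨x, rfl⟩ : ∃ x, r = v + x := ⟨r - v, by abel⟩
    rw [add_sub_add_left_eq_sub] at hr1 hr2
    rw [add_sub_cancel_left]
    have hc' : c = (a • u + b • w) - x := by
      have := hrc
      rw [add_assoc] at this
      rw [← add_left_cancel this]; abel
    refine le_trans (le_of_sq_le_sq ?_ (norm_nonneg _)) hc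
    have e1 : ‖x - u‖ ^ 2 ≤ d ^ 2 := by gcongr
    have e2 : ‖x - w‖ ^ 2 ≤ d ^ 2 := by gcongr
    rw [norm_sub_sq_real] at e1 e2
    rw [hu] at e1
    rw [hw] at e2
    rw [hc', norm_sub_sq_real (a • u + b • w) x, inner_add_left, inner_smul_left, inner_smul_left,
      real_inner_comm x u, real_inner_comm x w]
    simp only [conj_trivial]
    have f1 : 0 ≤ ⟪x, u⟫_ℝ := by nlinarith [sq_nonneg ‖x‖]
    have f2 : 0 ≤ ⟪x, w⟫_ℝ := by nlinarith [sq_nonneg ‖x‖]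
    nlinarith [sq_nonneg ‖x‖, mul_nonneg (neg_nonneg.2 ha) f1, mul_nonneg (neg_nonneg.2 hb) f2]
  · intro h
    have := sector_mem d hd v u w hu hw huw 0 0 le_rfl le_rfl (by simp [hd.le])
    refine ⟨_, this, a • u + b • w, ?_, by simp⟩
    simpa [dist_eq_norm] using h

theorem pos_mem_iff' (d : ℝ) (hd : 0 < d) (hd2 : d < 1) (K : Set E2) (v v' v'' p : E2)
    (hK : K = closedBall v d ∩ closedBall v' d ∩ closedBall v'' d + closedBall (0 : E2) (1 - d))
    (hu : ‖v' - v‖ = d) (hw : ‖v'' - v‖ = d)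
    (huw : ⟪v' - v, v'' - v⟫_ℝ = d ^ 2 / 2) (a b : ℝ) 
    (hp : p = v + (a • (v' - v) + b • (v'' - v))) :
    (0 ≤ a → 0 ≤ b → (p ∈ K ↔ p ∈ closedBall v 1)) ∧
    (a ≤ 0 → b ≤ 0 → (p ∈ K ↔ p ∈ closedBall v (1 - d))) := by
  have h1 := pos_mem_iff d hd hd2 v (v' - v) (v'' - v) hu hw huw a b
  have h2 := opp_mem_iff d hd hd2 v (v' - v) (v'' - v) hu hw huw a b
  rw [add_sub_cancel, add_sub_cancel, ← hK, ← hp] at h1 h2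
  exact ⟨h1, h2⟩

theorem null_line (a b c : ℝ) (h : a ^ 2 + b ^ 2 ≠ 0) :
    volume {p : E2 | a * p 0 + b * p 1 + c = 0} = 0 := by
  let f : E2 →ₗ[ℝ] ℝ := a • (EuclideanSpace.proj 0 : E2 →L[ℝ] ℝ).toLinearMap
    + b • (EuclideanSpace.proj 1 : E2 →L[ℝ] ℝ).toLinearMap
  have hf : ∀ p, f p = a * p 0 + b * p 1 := fun p => by simp [f]
  have hk : volume (LinearMap.ker f : Set E2) = 0 := by
    apply Measure.addHaar_submodule
    intro h0
    have : f (pt a b) = 0 := by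
      rw [← LinearMap.mem_ker, h0]; trivial
    rw [hf] at this
    apply h
    simp [pt] at this
    nlinarith
  rw [← measure_preimage_add_right volume (pt (-c * a / (a ^ 2 + b ^ 2)) (-c * b / (a ^ 2 + b ^ 2)))]
  convert hk using 2
  ext p
  simp only [Set.mem_preimage, Set.mem_ofPred_eq, SetLike.mem_coe, LinearMap.mem_ker, hf]
  have : a * (-c * a / (a ^ 2 + b ^ 2)) + b * (-c * b / (a ^ 2 + b ^ 2)) = -c := by
    field_simp
    ring
  simp only [pt, PiLp.add_apply, EuclideanSpace.equiv, PiLp.continuousLinearEquiv_symm_apply,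
    Matrix.cons_val_zero, Matrix.cons_val_one]
  constructor <;> intro h <;> linarith

theorem partition_measure (A : Set E2) (hA : MeasurableSet A) (g1 g2 g3 : E2 → ℝ)
    (h1 : Measurable g1) (h2 : Measurable g2) (h3 : Measurable g3)
    (hs : ∀ p, 0 ≤ g1 p + g2 p + g3 p)
    (n1 : volume {p | g1 p = 0} = 0) (n2 : volume {p | g2 p = 0} = 0)
    (n3 : volume {p | g3 p = 0} = 0) :
    volume A + (volume (A ∩ {p | 0 < g1 p ∧ 0 < g2 p ∧ 0 < g3 p})
      + volume (A ∩ {p | 0 < g1 p ∧ 0 < g2 p ∧ 0 < g3 p})) =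
    (volume (A ∩ {p | 0 < g2 p ∧ 0 < g3 p}) + volume (A ∩ {p | 0 < g3 p ∧ 0 < g1 p})
      + volume (A ∩ {p | 0 < g1 p ∧ 0 < g2 p})) +
    (volume (A ∩ {p | g2 p < 0 ∧ g3 p < 0}) + volume (A ∩ {p | g3 p < 0 ∧ g1 p < 0})
      + volume (A ∩ {p | g1 p < 0 ∧ g2 p < 0})) := by
  have mp : ∀ g : E2 → ℝ, Measurable g → MeasurableSet {p | 0 < g p} := fun g hg =>
    measurableSet_lt measurable_const hg
  have mn : ∀ g : E2 → ℝ, Measurable g → MeasurableSet {p | g p < 0} := fun g hg =>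
    measurableSet_lt hg measurable_const
  have mT := hA.inter ((mp g1 h1).inter ((mp g2 h2).inter (mp g3 h3)))
  have mP1 := hA.inter ((mp g2 h2).inter (mp g3 h3))
  have mP2 := hA.inter ((mp g3 h3).inter (mp g1 h1))
  have mP3 := hA.inter ((mp g1 h1).inter (mp g2 h2))
  have mQ1 := hA.inter ((mn g2 h2).inter (mn g3 h3))
  have mQ2 := hA.inter ((mn g3 h3).inter (mn g1 h1))
  have mQ3 := hA.inter ((mn g1 h1).inter (mn g2 h2))
  simp only [← Set.ofPred_and] at mT mP1 mP2 mP3 mQ1 mQ2 mQ3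
  have I : ∀ S : Set E2, MeasurableSet S → volume S = ∫⁻ p, S.indicator (fun _ => (1 : ℝ≥0∞)) p :=
    fun S hS => by rw [lintegral_indicator hS]; simp
  have M : ∀ S : Set E2, MeasurableSet S → Measurable (S.indicator (fun _ => (1 : ℝ≥0∞))) :=
    fun S hS => measurable_const.indicator hS
  have MT := M _ mT
  have MP1 := M _ mP1
  have MP2 := M _ mP2
  have MP3 := M _ mP3
  have MQ1 := M _ mQ1
  have MQ2 := M _ mQ2
  have MQ3 := M _ mQ3
  rw [I _ hA, I _ mT, I _ mP1, I _ mP2, I _ mP3, I _ mQ1, I _ mQ2, I _ mQ3,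
    ← lintegral_add_left MT, ← lintegral_add_left (M _ hA), ← lintegral_add_left MP1,
    ← lintegral_add_left (by fun_prop), ← lintegral_add_left MQ1, ← lintegral_add_left (by fun_prop),
    ← lintegral_add_left (by fun_prop)]
  apply lintegral_congr_ae
  have e1 : ∀ᵐ p, g1 p ≠ 0 := by rw [ae_iff]; simpa using n1
  have e2 : ∀ᵐ p, g2 p ≠ 0 := by rw [ae_iff]; simpa using n2
  have e3 : ∀ᵐ p, g3 p ≠ 0 := by rw [ae_iff]; simpa using n3
  filter_upwards [e1, e2, e3] with p k1 k2 k3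
  have hs := hs p
  by_cases hpA : p ∈ A
  · rcases lt_or_gt_of_ne k1 with c1 | c1 <;> rcases lt_or_gt_of_ne k2 with c2 | c2 <;>
      rcases lt_or_gt_of_ne k3 with c3 | c3 <;> 
      first
      | (exfalso; linarith)
      | (simp [Set.indicator, hpA, c1, c2, c3, c1.not_gt, c2.not_gt, c3.not_gt, add_assoc])
  · simp [Set.indicator, hpA]

theorem half_disc (r : ℝ) (hr : 0 ≤ r) (a1 b1 a2 b2 a3 b3 : ℝ)
    (h1 : a1 ^ 2 + b1 ^ 2 ≠ 0) (h2 : a2 ^ 2 + b2 ^ 2 ≠ 0) (h3 : a3 ^ 2 + b3 ^ 2 ≠ 0)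
    (ha : a1 + a2 + a3 = 0) (hb : b1 + b2 + b3 = 0) :
    2 * (volume (closedBall (0 : E2) r ∩ {p | 0 < a2 * p 0 + b2 * p 1 ∧ 0 < a3 * p 0 + b3 * p 1})
     + volume (closedBall (0 : E2) r ∩ {p | 0 < a3 * p 0 + b3 * p 1 ∧ 0 < a1 * p 0 + b1 * p 1})
     + volume (closedBall (0 : E2) r ∩ {p | 0 < a1 * p 0 + b1 * p 1 ∧ 0 < a2 * p 0 + b2 * p 1}))
      = ENNReal.ofReal (π * r ^ 2) := by
  have hz : ∀ p : E2, (a1 * p 0 + b1 * p 1) + (a2 * p 0 + b2 * p 1) + (a3 * p 0 + b3 * p 1) = 0 := by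
    intro p
    linear_combination p 0 * ha + p 1 * hb
  have := partition_measure (closedBall (0 : E2) r) measurableSet_closedBall
    (fun p => a1 * p 0 + b1 * p 1) (fun p => a2 * p 0 + b2 * p 1) (fun p => a3 * p 0 + b3 * p 1)
    (by fun_prop) (by fun_prop) (by fun_prop) (fun p => (hz p).ge)
    (by simpa using null_line a1 b1 0 h1) (by simpa using null_line a2 b2 0 h2)
    (by simpa using null_line a3 b3 0 h3)
  have hT : {p : E2 | 0 < a1 * p 0 + b1 * p 1 ∧ 0 < a2 * p 0 + b2 * p 1 ∧ 0 < a3 * p 0 + b3 * p 1}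
      = ∅ := by
    ext p
    simp only [Set.mem_ofPred_eq, Set.mem_empty_iff_false, iff_false]
    rintro ⟨x, y, z⟩
    linarith [hz p]
  have hneg : ∀ a b a' b' : ℝ,
      volume (closedBall (0 : E2) r ∩ {p | a * p 0 + b * p 1 < 0 ∧ a' * p 0 + b' * p 1 < 0}) =
      volume (closedBall (0 : E2) r ∩ {p | 0 < a * p 0 + b * p 1 ∧ 0 < a' * p 0 + b' * p 1}) := by
    intro a b a' b'
    rw [← Measure.measure_neg volume]
    congr 1
    ext p
    simp only [Set.mem_neg, Set.mem_inter_iff, mem_closedBall, dist_zero_right, norm_neg,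
      Set.mem_ofPred_eq, PiLp.neg_apply]
    refine and_congr Iff.rfl (and_congr ?_ ?_) <;> constructor <;> intro h <;> linarith
  simp only [hT, hneg, Set.inter_empty, measure_empty, add_zero] at this
  rw [two_mul, ← this, EuclideanSpace.volume_closedBall_fin_two, ENNReal.ofReal_mul pi_pos.le,
    ENNReal.ofReal_pow hr, mul_comm]

theorem volume_triangle (d : ℝ) (hd : 0 < d) :
    volume {p : E2 | 0 < -1 * p 0 + -(√3 / 3) * p 1 + d ∧ 0 < 1 * p 0 + -(√3 / 3) * p 1 + 0 ∧
      0 < 0 * p 0 + (2 * √3 / 3) * p 1 + 0} = ENNReal.ofReal (√3 / 4 * d ^ 2) := by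
  have h3 : √3 ^ 2 = 3 := Real.sq_sqrt (by norm_num)
  have hs : 0 < √3 := by positivity
  have mp : MeasurePreserving (fun p : E2 => (p 1, p 0)) :=
    (Measure.measurePreserving_swap (μ := (volume : Measure ℝ)) (ν := (volume : Measure ℝ))).comp
      ((volume_preserving_finTwoArrow ℝ).comp (PiLp.volume_preserving_ofLp (Fin 2)))
  have key := volume_regionBetween_eq_integral (μ := (volume : Measure ℝ))
    (f := fun y => √3 / 3 * y) (g := fun y => d - √3 / 3 * y) (s := Set.Ioc 0 (√3 / 2 * d))
    ((by fun_prop : Continuous _).integrableOn_Ioc) ((by fun_prop : Continuous _).integrableOn_Ioc)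
    measurableSet_Ioc (by
      rintro y ⟨hy0, hy⟩
      nlinarith)
  have hm : MeasurableSet (regionBetween (fun y => √3 / 3 * y) (fun y => d - √3 / 3 * y)
      (Set.Ioc 0 (√3 / 2 * d))) :=
    measurableSet_regionBetween (by fun_prop) (by fun_prop) measurableSet_Ioc
  have e : {p : E2 | 0 < -1 * p 0 + -(√3 / 3) * p 1 + d ∧ 0 < 1 * p 0 + -(√3 / 3) * p 1 + 0 ∧
      0 < 0 * p 0 + (2 * √3 / 3) * p 1 + 0} = (fun p : E2 => (p 1, p 0)) ⁻¹'
      (regionBetween (fun y => √3 / 3 * y) (fun y => d - √3 / 3 * y)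
      (Set.Ioc 0 (√3 / 2 * d))) := by
    ext p
    simp only [regionBetween, Set.mem_ofPred_eq, Set.mem_preimage, Set.mem_Ioc, Set.mem_Ioo]
    constructor
    · rintro ⟨x, y, z⟩
      have : 0 < p 1 := by
        by_contra hc
        push Not at hc
        nlinarith
      refine ⟨⟨this, ?_⟩, by linarith, by linarith⟩
      nlinarith
    · rintro ⟨⟨x, y⟩, z, w⟩
      refine ⟨by linarith, by linarith, ?_⟩
      have := mul_pos hs x
      linarith
  rw [e, mp.measure_preimage hm.nullMeasurableSet, Measure.volume_eq_prod, key,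
    ← intervalIntegral.integral_of_le (by positivity)]
  congr 1
  have : ∀ y, HasDerivAt (fun y : ℝ => d * y - √3 / 3 * y ^ 2)
      (((fun y => d - √3 / 3 * y) - fun y => √3 / 3 * y) y) y := by
    intro y
    have := ((hasDerivAt_id y).const_mul d).sub (((hasDerivAt_id y).pow 2).const_mul (√3 / 3))
    have h : HasDerivAt (fun y : ℝ => d * y - √3 / 3 * y ^ 2) _ y := this
    refine h.congr_deriv ?_
    simp
    ring
  rw [intervalIntegral.integral_eq_sub_of_hasDerivAt (fun y _ => this y)
    (Continuous.intervalIntegrable (by fun_prop) _ _)]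
  linear_combination (-d ^ 2 * √3 / 12) * h3

theorem cone_translate (v : E2) (r a b c a' b' c' : ℝ) (h : a * v 0 + b * v 1 + c = 0)
    (h' : a' * v 0 + b' * v 1 + c' = 0) :
    volume (closedBall v r ∩ {p | 0 < a * p 0 + b * p 1 + c ∧ 0 < a' * p 0 + b' * p 1 + c'}) =
    volume (closedBall (0 : E2) r ∩ {p | 0 < a * p 0 + b * p 1 ∧ 0 < a' * p 0 + b' * p 1}) := by
  rw [← measure_preimage_add_right volume v]
  congr 1
  ext p
  simp only [Set.mem_preimage, Set.mem_inter_iff, mem_closedBall, dist_eq_norm, sub_zero,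
    add_sub_cancel_right, Set.mem_ofPred_eq, PiLp.add_apply]
  refine and_congr Iff.rfl (and_congr ?_ ?_) <;> constructor <;> intro h <;> linarith

theorem cone_translate_neg (v : E2) (r a b c a' b' c' : ℝ) (h : a * v 0 + b * v 1 + c = 0)
    (h' : a' * v 0 + b' * v 1 + c' = 0) :
    volume (closedBall v r ∩ {p | a * p 0 + b * p 1 + c < 0 ∧ a' * p 0 + b' * p 1 + c' < 0}) =
    volume (closedBall (0 : E2) r ∩ {p | 0 < a * p 0 + b * p 1 ∧ 0 < a' * p 0 + b' * p 1}) := by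
  rw [← measure_preimage_add_right volume v, ← Measure.measure_neg volume]
  congr 1
  ext p
  simp only [Set.mem_neg, Set.mem_preimage, Set.mem_inter_iff, mem_closedBall, dist_eq_norm,
    sub_zero, norm_neg, 
    add_sub_cancel_right, Set.mem_ofPred_eq, PiLp.add_apply, PiLp.neg_apply]
  refine and_congr Iff.rfl (and_congr ?_ ?_) <;> constructor <;> intro h <;> linarith

theorem pt_zero (a b : ℝ) : pt a b 0 = a := by simp [pt]
theorem pt_one (a b : ℝ) : pt a b 1 = b := by simp [pt]

theorem norm_eq_of (p : E2) (d : ℝ) (hd : 0 < d) (h : p 0 ^ 2 + p 1 ^ 2 = d ^ 2) : ‖p‖ = d := by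
  rw [EuclideanSpace.norm_eq, Fin.sum_univ_two, Real.norm_eq_abs, Real.norm_eq_abs, sq_abs, sq_abs,
    h, Real.sqrt_sq hd.le]

theorem inner_eq' (p q : E2) : ⟪p, q⟫_ℝ = p 0 * q 0 + p 1 * q 1 := by
  simp [PiLp.inner_apply, Fin.sum_univ_two]
  ring

/-- Vertex lemma in coordinates. -/
theorem vertex_sets (d : ℝ) (hd : 0 < d) (hd2 : d < 1) (K : Set E2) (v v' v'' : E2)
    (hK : K = closedBall v d ∩ closedBall v' d ∩ closedBall v'' d + closedBall (0 : E2) (1 - d))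
    (hu : (v' 0 - v 0) ^ 2 + (v' 1 - v 1) ^ 2 = d ^ 2)
    (hw : (v'' 0 - v 0) ^ 2 + (v'' 1 - v 1) ^ 2 = d ^ 2)
    (huw : (v' 0 - v 0) * (v'' 0 - v 0) + (v' 1 - v 1) * (v'' 1 - v 1) = d ^ 2 / 2)
    (g g' : E2 → ℝ)
    (h0 : ∀ p : E2, d * (p 0 - v 0) = g p * (v' 0 - v 0) + g' p * (v'' 0 - v 0))
    (h1 : ∀ p : E2, d * (p 1 - v 1) = g p * (v' 1 - v 1) + g' p * (v'' 1 - v 1)) :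
    K ∩ {p | 0 < g p ∧ 0 < g' p} = closedBall v 1 ∩ {p | 0 < g p ∧ 0 < g' p} ∧
    K ∩ {p | g p < 0 ∧ g' p < 0} = closedBall v (1 - d) ∩ {p | g p < 0 ∧ g' p < 0} := by
  have key : ∀ p : E2, p = v + ((g p / d) • (v' - v) + (g' p / d) • (v'' - v)) := by
    intro p
    ext i
    fin_cases i
    · have := h0 p
      simp
      field_simp
      linarith
    · have := h1 p
      simp
      field_simp
      linarith
  have H := fun p => pos_mem_iff' d hd hd2 K v v' v'' p hK (norm_eq_of _ d hd (by simpa using hu))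
    (norm_eq_of _ d hd (by simpa using hw)) (by rw [inner_eq']; simpa using huw) _ _ (key p)
  constructor
  · ext p
    constructor
    · rintro ⟨x, y, z⟩
      exact ⟨((H p).1 (div_pos y hd).le (div_pos z hd).le).1 x, y, z⟩
    · rintro ⟨x, y, z⟩
      exact ⟨((H p).1 (div_pos y hd).le (div_pos z hd).le).2 x, y, z⟩
  · ext p
    constructor
    · rintro ⟨x, y, z⟩
      exact ⟨((H p).2 (div_neg_of_neg_of_pos y hd).le (div_neg_of_neg_of_pos z hd).le).1 x, y, z⟩
    · rintro ⟨x, y, z⟩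
      exact ⟨((H p).2 (div_neg_of_neg_of_pos y hd).le (div_neg_of_neg_of_pos z hd).le).2 x, y, z⟩

theorem final_arith (d : ℝ) (hd1 : 0 < d) (hd2 : d < 1) (k t s q : ℝ≥0∞)
    (h : k + (t + t) = s + q) (ht : t = ENNReal.ofReal (√3 / 4 * d ^ 2))
    (hs : 2 * s = ENNReal.ofReal (π * 1 ^ 2)) (hq : 2 * q = ENNReal.ofReal (π * (1 - d) ^ 2)) :
    k = ENNReal.ofReal (1 / 2 * (π - √3) * d ^ 2 - π * d + π) := by
  have hp := pi_pos
  have fs : s ≠ ⊤ := by rintro rfl; simp at hs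
  have fq : q ≠ ⊤ := by rintro rfl; simp at hq
  have ft : t ≠ ⊤ := by rw [ht]; simp
  have fk : k ≠ ⊤ := by
    rintro rfl
    simp only [top_add] at h
    exact (ENNReal.add_ne_top.2 ⟨fs, fq⟩) h.symm
  have h' := congrArg ENNReal.toReal h
  have hs' := congrArg ENNReal.toReal hs
  have hq' := congrArg ENNReal.toReal hq
  have ht' := congrArg ENNReal.toReal ht
  rw [ENNReal.toReal_add fk (by simp [ft]), ENNReal.toReal_add ft ft, ENNReal.toReal_add fs fq] at h'
  rw [ENNReal.toReal_mul, ENNReal.toReal_ofReal (by positivity), ENNReal.toReal_ofNat] at hs' hq'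
  rw [ENNReal.toReal_ofReal (by positivity)] at ht'
  rw [← ENNReal.ofReal_toReal fk]
  congr 1
  linarith

/-- The area of the outer parallel domain of radius `1 - d` of a Reuleaux
triangle of width `d` equals `(1/2)(π - √3)d² - πd + π`. -/
theorem area_outer_parallel_reuleaux (d : ℝ) (hd1 : 0 < d) (hd2 : d < 1) :
    volume ((closedBall (pt 0 0) d ∩ closedBall (pt d 0) d
          ∩ closedBall (pt (d / 2) (Real.sqrt 3 / 2 * d)) d)
        + closedBall (0 : E2) (1 - d))
      = ENNReal.ofReal (1 / 2 * (π - Real.sqrt 3) * d ^ 2 - π * d + π) := by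
  have h3 : √3 ^ 2 = 3 := Real.sq_sqrt (by norm_num)
  have hs : 0 < √3 := by positivity
  obtain ⟨K, hK⟩ : ∃ K, K = (closedBall (pt 0 0) d ∩ closedBall (pt d 0) d
          ∩ closedBall (pt (d / 2) (Real.sqrt 3 / 2 * d)) d) + closedBall (0 : E2) (1 - d) := ⟨_, rfl⟩
  rw [← hK]
  have mK : MeasurableSet K := by
    rw [hK]
    refine (IsCompact.add ?_ (isCompact_closedBall _ _)).isClosed.measurableSet
    exact ((isCompact_closedBall _ _).inter_right isClosed_closedBall).inter_right isClosed_closedBall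
  have hK2 : K = closedBall (pt d 0) d ∩ closedBall (pt (d / 2) (√3 / 2 * d)) d
      ∩ closedBall (pt 0 0) d + closedBall (0 : E2) (1 - d) := by
    rw [hK]; congr 1; ext p; simp only [Set.mem_inter_iff]; tauto
  have hK3 : K = closedBall (pt (d / 2) (√3 / 2 * d)) d ∩ closedBall (pt 0 0) d 
      ∩ closedBall (pt d 0) d + closedBall (0 : E2) (1 - d) := by
    rw [hK]; congr 1; ext p; simp only [Set.mem_inter_iff]; tauto
  let g1 : E2 → ℝ := fun p => -1 * p 0 + -(√3 / 3) * p 1 + d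
  let g2 : E2 → ℝ := fun p => 1 * p 0 + -(√3 / 3) * p 1 + 0
  let g3 : E2 → ℝ := fun p => 0 * p 0 + (2 * √3 / 3) * p 1 + 0
  obtain ⟨p1, q1⟩ := vertex_sets d hd1 hd2 K _ _ _ hK
    (by simp only [pt_zero, pt_one]; ring)
    (by simp only [pt_zero, pt_one]; linear_combination d ^ 2 / 4 * h3)
    (by simp only [pt_zero, pt_one]; ring) g2 g3
    (by intro p; simp only [pt_zero, pt_one, g2, g3]; ring)
    (by intro p; simp only [pt_zero, pt_one, g2, g3]; linear_combination -d * p 1 / 3 * h3)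
  obtain ⟨p2, q2⟩ := vertex_sets d hd1 hd2 K _ _ _ hK2
    (by simp only [pt_zero, pt_one]; linear_combination d ^ 2 / 4 * h3)
    (by simp only [pt_zero, pt_one]; ring)
    (by simp only [pt_zero, pt_one]; ring) g3 g1
    (by intro p; simp only [pt_zero, pt_one, g1, g3]; ring)
    (by intro p; simp only [pt_zero, pt_one, g1, g3]; linear_combination -d * p 1 / 3 * h3)
  obtain ⟨p3, q3⟩ := vertex_sets d hd1 hd2 K _ _ _ hK3
    (by simp only [pt_zero, pt_one]; linear_combination d ^ 2 / 4 * h3)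
    (by simp only [pt_zero, pt_one]; linear_combination d ^ 2 / 4 * h3)
    (by simp only [pt_zero, pt_one]; linear_combination d ^ 2 / 4 * h3) g1 g2
    (by intro p; simp only [pt_zero, pt_one, g1, g2]; ring)
    (by intro p; simp only [pt_zero, pt_one, g1, g2]; linear_combination -d * p 1 / 3 * h3)
  have n1 : (-1 : ℝ) ^ 2 + (-(√3 / 3)) ^ 2 ≠ 0 := by positivity
  have n2 : (1 : ℝ) ^ 2 + (-(√3 / 3)) ^ 2 ≠ 0 := by positivity
  have n3 : (0 : ℝ) ^ 2 + (2 * √3 / 3) ^ 2 ≠ 0 := by positivity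
  have main := partition_measure K mK g1 g2 g3 (by fun_prop) (by fun_prop) (by fun_prop)
    (by intro p; simp only [g1, g2, g3]; linarith)
    (null_line _ _ _ n1) (null_line _ _ _ n2) (null_line _ _ _ n3)
  have hT : K ∩ {p | 0 < g1 p ∧ 0 < g2 p ∧ 0 < g3 p} = {p | 0 < g1 p ∧ 0 < g2 p ∧ 0 < g3 p} := by
    apply Set.inter_eq_right.2
    rintro p ⟨x, y, z⟩
    have : p ∈ closedBall (pt 0 0) 1 ∩ {p | 0 < g2 p ∧ 0 < g3 p} := by
      refine ⟨?_, y, z⟩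
      rw [mem_closedBall, dist_eq_norm]
      refine le_of_sq_le_sq ?_ zero_le_one
      rw [EuclideanSpace.norm_sq_eq, Fin.sum_univ_two]
      simp only [PiLp.sub_apply, pt_zero, pt_one, sub_zero, Real.norm_eq_abs, sq_abs]
      simp only [g1, g2, g3] at x y z
      have y1 : 0 < √3 / 3 * p 1 := by linarith
      have e : p 1 ^ 2 = 3 * (√3 / 3 * p 1) ^ 2 := by linear_combination -p 1 ^ 2 / 3 * h3
      rw [e]
      generalize √3 / 3 * p 1 = Y at *
      generalize p 0 = X at *
      nlinarith
    rw [← p1] at this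
    exact this.1
  rw [hT, p1, p2, p3, q1, q2, q3] at main
  have hS := half_disc 1 zero_le_one _ _ _ _ _ _ n1 n2 n3 (by ring) (by ring)
  have hQ := half_disc (1 - d) (by linarith) _ _ _ _ _ _ n1 n2 n3 (by ring) (by ring)
  simp only [g1, g2, g3] at main
  have s0 : √3 / 3 * (√3 / 2 * d) = d / 2 := by linear_combination d / 6 * h3
  rw [cone_translate, cone_translate, cone_translate, cone_translate_neg, cone_translate_neg,
    cone_translate_neg] at main
  · exact final_arith d hd1 hd2 _ _ _ _ main (volume_triangle d hd1) hS hQ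
  all_goals
    simp only [pt_zero, pt_one]
    linarith
end
end
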